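/- arXiv:1610.07814 — 4 statements merged into one kernel-verified Lean document; each statement's English description precedes it below -/
import Mathlib

section
/- Let θ be a minimizer of the energy E over H¹_{0,1} for some b > 0. Then θ is smooth, strictly increasing on [0,1], concave (θ'' < 0 on [0,1)), and satisfies 0 ≤ θ(s) < π/2 for all s ∈ [0,1]; in particular θ(1) < π/2. -/
open MeasureTheory Real Set

/-- Total energy `E(θ) = (1/2)∫₀¹ θ'² − b ∫₀¹ (1−s) sin θ(s) ds`,
where `θ'` is the (weak) derivative of `θ`. -/
noncomputable def energy (b : ℝ) (θ θ' : ℝ → ℝ) : ℝ :=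
  (1/2) * (∫ s in (0:ℝ)..1, (θ' s)^2) - b * ∫ s in (0:ℝ)..1, (1 - s) * Real.sin (θ s)

/-- `θ ∈ H¹([0,1])` with `θ(0) = 0`, represented by a square-integrable weak
derivative `θ'` of which `θ` is the primitive. -/
def InH101 (θ θ' : ℝ → ℝ) : Prop :=
  (∀ s ∈ Set.Icc (0:ℝ) 1, θ s = ∫ t in (0:ℝ)..s, θ' t) ∧
  IntervalIntegrable θ' MeasureTheory.volume 0 1 ∧
  IntervalIntegrable (fun s => (θ' s)^2) MeasureTheory.volume 0 1

/-- `θ` is a global minimizer of the energy `E_b` on `H¹_{0,1}`. -/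
def IsMinimizer (b : ℝ) (θ θ' : ℝ → ℝ) : Prop :=
  InH101 θ θ' ∧ ∀ ψ ψ', InH101 ψ ψ' → energy b θ θ' ≤ energy b ψ ψ'

/-- A classical solution of the Euler–Lagrange boundary value problem
`θ'' = −b(1−s) cos θ`, `θ(0) = 0`, `θ'(1) = 0`. -/
def ClassicalSolution (b : ℝ) (θ : ℝ → ℝ) : Prop :=
  ContDiff ℝ 2 θ ∧ θ 0 = 0 ∧ deriv θ 1 = 0 ∧
  ∀ s ∈ Set.Icc (0:ℝ) 1, deriv (deriv θ) s = -b * (1 - s) * Real.cos (θ s)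



lemma sin_lower (x h : ℝ) : Real.sin x + h * Real.cos x - 3 * h ^ 2 ≤ Real.sin (x + h) := by
  rw [Real.sin_add]
  have h1 : |h - Real.sin h| ≤ 2 * h ^ 2 := by
    rcases le_total |h| 1 with hh | hh
    · have := Real.abs_sub_sin_le h
      have h3 : |h| ^ 3 ≤ |h| ^ 2 := pow_le_pow_of_le_one (abs_nonneg _) hh (by norm_num)
      rw [sq_abs] at h3
      nlinarith [sq_nonneg h]
    · have h4 : |h - Real.sin h| ≤ |h| + |Real.sin h| := abs_sub _ _
      have h5 := Real.abs_sin_le_one h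
      have : |h| ^ 2 = h ^ 2 := sq_abs h
      nlinarith
  have h2 : 1 - h ^ 2 / 2 ≤ Real.cos h := Real.one_sub_sq_div_two_le_cos
  have h3 := Real.cos_le_one h
  have h4 := Real.sin_le_one x
  have h6 : |Real.cos x * (h - Real.sin h)| ≤ 2 * h ^ 2 := by
    rw [abs_mul]
    calc _ ≤ 1 * |h - Real.sin h| := by
          gcongr; exact Real.abs_cos_le_one x
      _ ≤ _ := by linarith
  have h7 := (abs_le.1 h6).2
  have h8 : Real.sin x * (1 - Real.cos h) ≤ 1 * (1 - Real.cos h) := by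
    have : 0 ≤ 1 - Real.cos h := by linarith
    gcongr
  nlinarith

lemma ibp_prim {g p : ℝ → ℝ} (hg : Continuous g) (hp : IntervalIntegrable p volume 0 1) :
    ∫ s in (0:ℝ)..1, (-∫ t in (1:ℝ)..s, g t) * p s =
      ∫ s in (0:ℝ)..1, g s * ∫ t in (0:ℝ)..s, p t := by
  have hA : AbsolutelyContinuousOnInterval (fun s => ∫ t in (1:ℝ)..s, g t) 0 1 :=
    (hg.intervalIntegrable 0 1).absolutelyContinuousOnInterval_intervalIntegral (by simp)
  have hB : AbsolutelyContinuousOnInterval (fun s => ∫ t in (0:ℝ)..s, p t) 0 1 :=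
    hp.absolutelyContinuousOnInterval_intervalIntegral (by simp)
  have h := hA.integral_mul_deriv_eq_deriv_mul hB
  have e1 : ∫ s in (0:ℝ)..1, (∫ t in (1:ℝ)..s, g t) * deriv (fun s => ∫ t in (0:ℝ)..s, p t) s
      = ∫ s in (0:ℝ)..1, (∫ t in (1:ℝ)..s, g t) * p s := by
    apply intervalIntegral.integral_congr_ae
    filter_upwards [hp.ae_hasDerivAt_integral] with x hx hx'
    rw [(hx (uIoc_subset_uIcc hx') 0 (by simp)).deriv]
  have e2 : ∀ s, deriv (fun s => ∫ t in (1:ℝ)..s, g t) s = g s := fun s =>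
    hg.deriv_integral g 1 s
  rw [e1] at h
  simp only [e2, intervalIntegral.integral_same, zero_mul, mul_zero, sub_zero, zero_sub] at h
  simp only [neg_mul, intervalIntegral.integral_neg, h, neg_neg]

lemma InH101.cont {θ θ' : ℝ → ℝ} (h : InH101 θ θ') : ContinuousOn θ (Icc 0 1) := by
  have := (h.2.1.absolutelyContinuousOnInterval_intervalIntegral (c := 0) (by simp)).continuousOn
  rw [uIcc_of_le zero_le_one] at this
  exact this.congr h.1

lemma memLp_of {p : ℝ → ℝ} (h1 : IntervalIntegrable p volume 0 1)
    (h2 : IntervalIntegrable (fun s => p s ^ 2) volume 0 1) :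
    MemLp p 2 (volume.restrict (Ioc (0:ℝ) 1)) :=
  (memLp_two_iff_integrable_sq h1.1.aestronglyMeasurable).2 h2.1

lemma ii_of {p q : ℝ → ℝ} (h1 : MemLp p 2 (volume.restrict (Ioc (0:ℝ) 1)))
    (h2 : MemLp q 2 (volume.restrict (Ioc (0:ℝ) 1))) :
    IntervalIntegrable (fun s => p s * q s) volume 0 1 := by
  rw [intervalIntegrable_iff_integrableOn_Ioc_of_le zero_le_one]
  exact h1.integrable_mul h2

lemma EL {b : ℝ} (hb : 0 < b) {θ θ' : ℝ → ℝ} (hmin : IsMinimizer b θ θ') :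
    ∃ Θ F : ℝ → ℝ, (∀ s ∈ Icc (0:ℝ) 1, θ s = Θ s) ∧ (∀ s, HasDerivAt Θ (F s) s) ∧
      (∀ s ∈ Icc (0:ℝ) 1, HasDerivAt F (-(b * (1 - s) * Real.cos (θ s))) s) ∧ F 1 = 0 ∧
      Θ 0 = 0 := by
  obtain ⟨hH, hm⟩ := hmin
  have hθc := hH.cont
  obtain ⟨h1, h2, h3⟩ := hH
  set c : ℝ → ℝ := fun s => max 0 (min s 1) with hc
  have hcc : Continuous c := by fun_prop
  have hcm : ∀ s, c s ∈ Icc (0:ℝ) 1 := fun s => ⟨le_max_left _ _, by simp [hc]⟩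
  have hcs : ∀ s ∈ Icc (0:ℝ) 1, c s = s := fun s hs => by
    simp [hc, hs.1, hs.2]
  have hθcc : Continuous (fun s => θ (c s)) := hθc.comp_continuous hcc hcm
  set g : ℝ → ℝ := fun s => b * (1 - s) * Real.cos (θ (c s)) with hg
  have hgc : Continuous g := 
    (continuous_const.mul (continuous_const.sub continuous_id)).mul (Real.continuous_cos.comp hθcc)
  set F : ℝ → ℝ := fun s => -∫ t in (1:ℝ)..s, g t with hF
  have hFd : ∀ s, HasDerivAt F (-g s) s := fun s => (hgc.integral_hasStrictDerivAt 1 s).hasDerivAt.neg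
  have hFc : Continuous F := continuous_iff_continuousAt.2 fun s => (hFd s).continuousAt
  have hFi := hFc.intervalIntegrable (μ := volume) 0 1
  set p : ℝ → ℝ := fun s => θ' s - F s with hp
  have hpi : IntervalIntegrable p volume 0 1 := h2.sub hFi
  set φ : ℝ → ℝ := fun s => ∫ t in (0:ℝ)..s, p t with hφ
  have mθ := memLp_of h2 h3
  have mF := memLp_of hFi ((hFc.pow 2).intervalIntegrable 0 1)
  have mp : MemLp p 2 (volume.restrict (Ioc (0:ℝ) 1)) := mθ.sub mF
  have ipp : IntervalIntegrable (fun s => p s ^ 2) volume 0 1 := by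
    simpa only [sq] using ii_of mp mp
  have iθp := ii_of mθ mp
  have iFp := ii_of mF mp
  have hφH : InH101 φ p := ⟨fun s _ => rfl, hpi, ipp⟩
  have hφc := hφH.cont
  have sub01 : ∀ s ∈ Icc (0:ℝ) 1, uIcc 0 s ⊆ uIcc (0:ℝ) 1 := fun s hs => by
    rw [uIcc_of_le hs.1, uIcc_of_le zero_le_one]; exact Icc_subset_Icc_right hs.2
  have ibp : ∫ s in (0:ℝ)..1, F s * p s = ∫ s in (0:ℝ)..1, g s * φ s := ibp_prim hgc hpi
  have ci : ∀ f : ℝ → ℝ, ContinuousOn f (Icc 0 1) → IntervalIntegrable f volume 0 1 := fun f hf =>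
    ContinuousOn.intervalIntegrable (by rwa [uIcc_of_le zero_le_one])
  set Q := ∫ s in (0:ℝ)..1, p s ^ 2 with hQ
  set R := ∫ s in (0:ℝ)..1, (1 - s) * φ s ^ 2 with hR
  have hQL : Q = (∫ s in (0:ℝ)..1, θ' s * p s) - ∫ s in (0:ℝ)..1, g s * φ s := by
    rw [← ibp, ← intervalIntegral.integral_sub iθp iFp]
    apply intervalIntegral.integral_congr
    intro s _
    simp only [hp]; ring
  have key : ∀ t : ℝ, 0 ≤ t * Q + t ^ 2 * (Q / 2 + 3 * b * R) := by
    intro t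
    have hψ : InH101 (fun s => θ s + t * φ s) (fun s => θ' s + t * p s) := by
      refine ⟨fun s hs => ?_, h2.add (hpi.const_mul t), ?_⟩
      · simp only
        rw [intervalIntegral.integral_add (h2.mono_set (sub01 s hs))
          ((hpi.const_mul t).mono_set (sub01 s hs)), h1 s hs, intervalIntegral.integral_const_mul]
      · have : MemLp (fun s => θ' s + t * p s) 2 (volume.restrict (Ioc (0:ℝ) 1)) :=
          mθ.add (mp.const_mul t)
        simpa only [sq] using ii_of this this
    have hE := hm _ _ hψ
    unfold energy at hE
    have e1 : ∫ s in (0:ℝ)..1, (θ' s + t * p s) ^ 2 =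
        (∫ s in (0:ℝ)..1, θ' s ^ 2) + 2 * t * (∫ s in (0:ℝ)..1, θ' s * p s) + t ^ 2 * Q := by
      rw [hQ, ← intervalIntegral.integral_const_mul, ← intervalIntegral.integral_const_mul,
        ← intervalIntegral.integral_add h3 (iθp.const_mul _),
        ← intervalIntegral.integral_add (h3.add (iθp.const_mul _)) (ipp.const_mul _)]
      apply intervalIntegral.integral_congr
      intro s _
      simp only; ring
    have e2 : b * (∫ s in (0:ℝ)..1, (1 - s) * Real.sin (θ s)) + t * (∫ s in (0:ℝ)..1, g s * φ s)
        - 3 * b * t ^ 2 * R ≤ b * ∫ s in (0:ℝ)..1, (1 - s) * Real.sin (θ s + t * φ s) := by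
      have j1 : IntervalIntegrable (fun s => b * ((1 - s) * Real.sin (θ s))) volume 0 1 :=
        ci _ (by fun_prop)
      have j2 : IntervalIntegrable (fun s => t * (g s * φ s)) volume 0 1 :=
        ci _ (by have := hgc.continuousOn (s := Icc 0 1); fun_prop)
      have j3 : IntervalIntegrable (fun s => 3 * b * t ^ 2 * ((1 - s) * φ s ^ 2)) volume 0 1 :=
        ci _ (by fun_prop)
      have j4 : IntervalIntegrable (fun s => b * ((1 - s) * Real.sin (θ s + t * φ s))) volume 0 1 :=
        ci _ (by fun_prop)
      rw [hR]
      simp only [← intervalIntegral.integral_const_mul]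
      rw [← intervalIntegral.integral_add j1 j2, ← intervalIntegral.integral_sub (j1.add j2) j3]
      apply intervalIntegral.integral_mono_on zero_le_one ((j1.add j2).sub j3) j4
      intro s hs
      have := sin_lower (θ s) (t * φ s)
      have hbs : 0 ≤ b * (1 - s) := mul_nonneg hb.le (by linarith [hs.2])
      have := mul_le_mul_of_nonneg_left this hbs
      simp only [hg, hcs s hs]
      nlinarith
    rw [e1] at hE
    simp only at hE
    have hQt : t * Q = t * (∫ s in (0:ℝ)..1, θ' s * p s) - t * ∫ s in (0:ℝ)..1, g s * φ s := by
      rw [hQL]; ring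
    linarith
  have hQ0 : Q = 0 := by
    have hQn : 0 ≤ Q := intervalIntegral.integral_nonneg zero_le_one fun s _ => sq_nonneg _
    by_contra hne
    have hpos : 0 < Q := lt_of_le_of_ne hQn (Ne.symm hne)
    set K := Q / 2 + 3 * b * R
    have h0 := key (-(Q / (2 * (|K| + 1))))
    have hK : 0 < |K| + 1 := by positivity
    set e := Q / (2 * (|K| + 1)) with he
    have hepos : 0 < e := by positivity
    have heq : e * (2 * (|K| + 1)) = Q := by rw [he]; field_simp
    have h5 : e * K ≤ e * |K| := by gcongr; exact le_abs_self K
    have h6 : 0 ≤ e * (-Q + e * K) := by nlinarith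
    have h7 : 0 ≤ -Q + e * K := nonneg_of_mul_nonneg_right h6 hepos
    nlinarith
  have hp0 : ∀ᵐ s ∂(volume.restrict (Ioc (0:ℝ) 1)), p s = 0 := by
    have := (intervalIntegral.integral_eq_zero_iff_of_le_of_nonneg_ae zero_le_one
      (Filter.Eventually.of_forall fun s => sq_nonneg (p s)) ipp).1 hQ0
    filter_upwards [this] with s hs
    simpa using hs
  have hφ0 : ∀ s ∈ Icc (0:ℝ) 1, φ s = 0 := by
    intro s hs
    apply intervalIntegral.integral_zero_ae
    have := (ae_restrict_iff' measurableSet_Ioc).1 hp0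
    filter_upwards [this] with x hx hx'
    rw [uIoc_of_le hs.1] at hx'
    exact hx ⟨hx'.1, hx'.2.trans hs.2⟩
  refine ⟨fun s => ∫ t in (0:ℝ)..s, F t, F, ?_, fun s => (hFc.integral_hasStrictDerivAt 0 s).hasDerivAt,
    ?_, by simp [hF], by simp⟩
  · intro s hs
    have := hφ0 s hs
    simp only [hφ, hp] at this
    rw [intervalIntegral.integral_sub (h2.mono_set (sub01 s hs)) (hFi.mono_set (sub01 s hs)),
      ← h1 s hs] at this
    linarith
  · intro s hs
    have := hFd s
    simp only [hg, hcs s hs] at this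
    exact this

lemma V_lt {b : ℝ} (hb : 0 < b) {θ θ' : ℝ → ℝ} (hmin : IsMinimizer b θ θ') :
    ∫ t in (0:ℝ)..1, |θ' t| < π / 2 := by
  by_contra hcon
  push Not at hcon
  obtain ⟨⟨h1, h2, h3⟩, hm⟩ := hmin
  have hθc := InH101.cont ⟨h1, h2, h3⟩
  have habs : IntervalIntegrable (fun t => |θ' t|) volume 0 1 := h2.abs
  set V : ℝ → ℝ := fun s => ∫ t in (0:ℝ)..s, |θ' t| with hV
  have hVc : ContinuousOn V (Icc 0 1) := by
    have := (habs.absolutelyContinuousOnInterval_intervalIntegral (c := 0) (by simp)).continuousOn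
    rwa [uIcc_of_le zero_le_one] at this
  have sub : ∀ x ∈ Icc (0:ℝ) 1, ∀ y ∈ Icc (0:ℝ) 1, uIcc x y ⊆ uIcc (0:ℝ) 1 := fun x hx y hy => by
    rw [uIcc_of_le zero_le_one]; exact uIcc_subset_Icc hx hy
  have z0 : (0:ℝ) ∈ Icc (0:ℝ) 1 := by simp
  have z1 : (1:ℝ) ∈ Icc (0:ℝ) 1 := by simp
  have hV0 : V 0 = 0 := by simp [hV]
  have hθV : ∀ s ∈ Icc (0:ℝ) 1, |θ s| ≤ V s := fun s hs => by
    rw [h1 s hs]; exact intervalIntegral.abs_integral_le_integral_abs hs.1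
  obtain ⟨s0, hs0, hVs0⟩ : π / 2 ∈ V '' Icc 0 1 :=
    intermediate_value_Icc zero_le_one hVc ⟨by rw [hV0]; positivity, hcon⟩
  set q : ℝ → ℝ := (Iic s0).indicator (fun t => |θ' t|) with hq
  have hq0 : ∀ t, 0 ≤ q t := fun t => indicator_nonneg (fun _ _ => abs_nonneg _) _
  have hqi : IntervalIntegrable q volume 0 1 := by
    rw [intervalIntegrable_iff] at habs ⊢
    exact habs.indicator measurableSet_Iic
  have hq2 : (fun s => q s ^ 2) = (Iic s0).indicator (fun t => θ' t ^ 2) := by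
    funext t
    by_cases ht : t ∈ Iic s0 <;> simp [hq, ht]
  have hq2i : IntervalIntegrable (fun s => q s ^ 2) volume 0 1 := by
    rw [hq2]
    rw [intervalIntegrable_iff] at h3 ⊢
    exact h3.indicator measurableSet_Iic
  set ψ : ℝ → ℝ := fun s => ∫ t in (0:ℝ)..s, q t with hψ
  have hψH : InH101 ψ q := ⟨fun s _ => rfl, hqi, hq2i⟩
  have hψ1 : ∀ s ∈ Icc (0:ℝ) s0, ψ s = V s := by
    intro s hs
    apply intervalIntegral.integral_congr
    intro t ht
    rw [uIcc_of_le hs.1] at ht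
    have : t ∈ Iic s0 := ht.2.trans hs.2
    simp [hq, this]
  have hψs0 : ψ s0 = π / 2 := by rw [hψ1 s0 ⟨hs0.1, le_rfl⟩, hVs0]
  have hmono : ∀ x ∈ Icc (0:ℝ) 1, ∀ y ∈ Icc (0:ℝ) 1, x ≤ y → ψ x ≤ ψ y := by
    intro x hx y hy hxy
    have := intervalIntegral.integral_add_adjacent_intervals (hqi.mono_set (sub 0 z0 x hx))
      (hqi.mono_set (sub x hx y hy))
    have h5 : 0 ≤ ∫ t in x..y, q t := intervalIntegral.integral_nonneg hxy fun t _ => hq0 t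
    simp only [hψ]
    linarith
  have hψ2 : ∀ s ∈ Icc s0 1, ψ s = π / 2 := by
    intro s hs
    have hs' : s ∈ Icc (0:ℝ) 1 := ⟨hs0.1.trans hs.1, hs.2⟩
    have := intervalIntegral.integral_add_adjacent_intervals (hqi.mono_set (sub 0 z0 s0 hs0))
      (hqi.mono_set (sub s0 hs0 s hs'))
    have h5 : ∫ t in s0..s, q t = 0 := by
      apply intervalIntegral.integral_zero_ae
      refine Filter.Eventually.of_forall fun t ht => ?_
      rw [uIoc_of_le hs.1] at ht
      have : t ∉ Iic s0 := by simpa using ht.1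
      simp [hq, this]
    rw [h5, add_zero] at this
    rw [← hψs0]
    exact this.symm
  have hψ11 : ψ 1 = π / 2 := hψ2 1 ⟨hs0.2, le_rfl⟩
  have hψ00 : ψ 0 = 0 := by simp [hψ]
  have hψnn : ∀ s ∈ Icc (0:ℝ) 1, 0 ≤ ψ s := fun s hs => by
    rw [← hψ00]; exact hmono 0 z0 s hs hs.1
  have hψle : ∀ s ∈ Icc (0:ℝ) 1, ψ s ≤ π / 2 := fun s hs => by
    rw [← hψ11]; exact hmono s hs 1 z1 hs.2
  have hsin : ∀ s ∈ Icc (0:ℝ) 1, Real.sin (θ s) ≤ Real.sin (ψ s) := by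
    intro s hs
    rcases le_total s s0 with h | h
    · have hv := hθV s hs
      rw [← hψ1 s ⟨hs.1, h⟩] at hv
      have hv' := abs_le.1 hv
      have := hψle s hs
      exact Real.sin_le_sin_of_le_of_le_pi_div_two (by linarith) this hv'.2
    · rw [hψ2 s ⟨h, hs.2⟩, Real.sin_pi_div_two]; exact Real.sin_le_one _
  have hψc := hψH.cont
  have ci : ∀ f : ℝ → ℝ, ContinuousOn f (Icc 0 1) → IntervalIntegrable f volume 0 1 := fun f hf =>
    ContinuousOn.intervalIntegrable (by rwa [uIcc_of_le zero_le_one])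
  have hEle : energy b ψ q ≤ energy b θ θ' := by
    unfold energy
    have e1 : ∫ s in (0:ℝ)..1, q s ^ 2 ≤ ∫ s in (0:ℝ)..1, θ' s ^ 2 := by
      apply intervalIntegral.integral_mono_on zero_le_one hq2i h3
      intro s _
      rw [show q s ^ 2 = _ from congrFun hq2 s]
      exact indicator_le_self' (fun _ _ => sq_nonneg _) s
    have e2 : ∫ s in (0:ℝ)..1, (1 - s) * Real.sin (θ s) ≤
        ∫ s in (0:ℝ)..1, (1 - s) * Real.sin (ψ s) := by
      apply intervalIntegral.integral_mono_on zero_le_one (ci _ (by fun_prop)) (ci _ (by fun_prop))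
      intro s hs
      exact mul_le_mul_of_nonneg_left (hsin s hs) (by linarith [hs.2])
    have e3 := mul_le_mul_of_nonneg_left e2 hb.le
    linarith
  have hψmin : IsMinimizer b ψ q := ⟨hψH, fun χ χ' h => hEle.trans (hm χ χ' h)⟩
  obtain ⟨Ψ, G, hΨ, hΨd, hGd, hG1, hΨ0⟩ := EL hb hψmin
  have hGle : ∀ s ∈ Icc (0:ℝ) 1, G s ≤ b * (π / 2 - ψ s) := by
    intro s hs
    rcases eq_or_lt_of_le hs.2 with h | h
    · subst h; rw [hG1, hψ11]; simp
    · have hin : ∀ t ∈ Icc s 1, t ∈ Icc (0:ℝ) 1 := fun t ht => ⟨hs.1.trans ht.1, ht.2⟩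
      obtain ⟨x, hx, hxe⟩ := exists_hasDerivAt_eq_slope G _ h
        (fun t ht => (hGd t (hin t ht)).continuousAt.continuousWithinAt)
        (fun t ht => hGd t (hin t ⟨ht.1.le, ht.2.le⟩))
      have hx' : x ∈ Icc (0:ℝ) 1 := hin x ⟨hx.1.le, hx.2.le⟩
      have hpos : 0 < 1 - s := by linarith
      rw [hG1, eq_div_iff hpos.ne'] at hxe
      have hu : Real.cos (ψ x) ≤ π / 2 - ψ s := by
        rw [← Real.sin_pi_div_two_sub]
        have := Real.sin_le (x := π / 2 - ψ x) (by linarith [hψle x hx'])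
        linarith [hmono s hs x hx' hx.1.le]
      have hc0 : 0 ≤ Real.cos (ψ x) :=
        Real.cos_nonneg_of_mem_Icc ⟨by linarith [hψnn x hx', Real.pi_pos], hψle x hx'⟩
      have h7 : (1 - x) * (1 - s) ≤ 1 := by nlinarith [hx'.1, hx'.2, hs.1, hs.2]
      calc G s = b * (((1 - x) * (1 - s)) * Real.cos (ψ x)) := by linarith
        _ ≤ b * (1 * Real.cos (ψ x)) := by gcongr
        _ ≤ b * (π / 2 - ψ s) := by rw [one_mul]; gcongr
  have hwd : ∀ s, HasDerivAt (fun s => (π / 2 - Ψ s) * Real.exp (b * s))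
      ((-G s) * Real.exp (b * s) + (π / 2 - Ψ s) * (Real.exp (b * s) * b)) s := by
    intro s
    have he : HasDerivAt (fun s => Real.exp (b * s)) (Real.exp (b * s) * b) s := by
      simpa using ((hasDerivAt_id s).const_mul b).exp
    exact ((hΨd s).const_sub (π / 2)).mul he
  have hwm : MonotoneOn (fun s => (π / 2 - Ψ s) * Real.exp (b * s)) (Icc 0 1) := by
    apply monotoneOn_of_deriv_nonneg (convex_Icc 0 1)
    · exact fun s _ => (hwd s).continuousAt.continuousWithinAt
    · exact fun s _ => (hwd s).differentiableAt.differentiableWithinAt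
    · intro s hs
      have hs := interior_subset hs
      rw [(hwd s).deriv, ← hΨ s hs]
      have := hGle s hs
      have he := Real.exp_pos (b * s)
      have h8 : 0 ≤ Real.exp (b * s) * (b * (π / 2 - ψ s) - G s) :=
        mul_nonneg he.le (by linarith)
      linarith
  have hfin := hwm z0 z1 zero_le_one
  simp only [← hΨ 1 z1, hΨ0, hψ11] at hfin
  simp at hfin
  linarith [Real.pi_pos]

/-- the minimizer of the energy is smooth, strictly increasing,
concave (`θ'' < 0` on `[0,1)`), with `0 ≤ θ(s) < π/2`; in particular `θ(1) < π/2`. -/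
theorem minimizer_properties (b : ℝ) (hb : 0 < b) (θ θ' : ℝ → ℝ)
    (hmin : IsMinimizer b θ θ') :
    ContDiffOn ℝ (⊤ : ℕ∞) θ (Set.Icc 0 1) ∧
    StrictMonoOn θ (Set.Icc 0 1) ∧
    (∀ s ∈ Set.Ico (0:ℝ) 1,
      derivWithin (derivWithin θ (Set.Icc 0 1)) (Set.Icc 0 1) s < 0) ∧
    (∀ s ∈ Set.Icc (0:ℝ) 1, 0 ≤ θ s ∧ θ s < π / 2) ∧
    θ 1 < π / 2 := by
  have hV := V_lt hb hmin
  obtain ⟨Θ, F, hΘ, hΘd, hFd, hF1, hΘ0⟩ := EL hb hmin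
  have z0 : (0:ℝ) ∈ Icc (0:ℝ) 1 := by simp
  have z1 : (1:ℝ) ∈ Icc (0:ℝ) 1 := by simp
  obtain ⟨⟨h1, h2, h3⟩, -⟩ := hmin
  have hθabs : ∀ s ∈ Icc (0:ℝ) 1, |θ s| < π / 2 := by
    intro s hs
    refine lt_of_le_of_lt ?_ hV
    rw [h1 s hs]
    refine (intervalIntegral.abs_integral_le_integral_abs hs.1).trans ?_
    exact intervalIntegral.integral_mono_interval le_rfl hs.1 hs.2
      (Filter.Eventually.of_forall fun t => abs_nonneg _) h2.abs
  have hcos : ∀ s ∈ Icc (0:ℝ) 1, 0 < Real.cos (θ s) := fun s hs => by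
    have := abs_lt.1 (hθabs s hs)
    exact Real.cos_pos_of_mem_Ioo ⟨this.1, this.2⟩
  have hud : UniqueDiffOn ℝ (Icc (0:ℝ) 1) := uniqueDiffOn_Icc zero_lt_one
  have hneg : ∀ s ∈ Ico (0:ℝ) 1, -(b * (1 - s) * Real.cos (θ s)) < 0 := fun s hs => by
    have h4 := hcos s ⟨hs.1, hs.2.le⟩
    have h5 : 0 < 1 - s := by linarith [hs.2]
    have : 0 < b * (1 - s) * Real.cos (θ s) := by positivity
    linarith
  have hFanti : StrictAntiOn F (Icc 0 1) := by
    apply strictAntiOn_of_deriv_neg (convex_Icc 0 1)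
    · exact fun s hs => (hFd s hs).continuousAt.continuousWithinAt
    · intro s hs
      rw [interior_Icc] at hs
      rw [(hFd s ⟨hs.1.le, hs.2.le⟩).deriv]
      exact hneg s ⟨hs.1.le, hs.2⟩
  have hΘmono : StrictMonoOn Θ (Icc 0 1) := by
    apply strictMonoOn_of_deriv_pos (convex_Icc 0 1)
    · exact fun s hs => (hΘd s).continuousAt.continuousWithinAt
    · intro s hs
      rw [interior_Icc] at hs
      rw [(hΘd s).deriv, ← hF1]
      exact hFanti ⟨hs.1.le, hs.2.le⟩ z1 hs.2
  have hmono : StrictMonoOn θ (Icc 0 1) := fun x hx y hy hxy => by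
    rw [hΘ x hx, hΘ y hy]; exact hΘmono hx hy hxy
  have hd1 : ∀ s ∈ Icc (0:ℝ) 1, HasDerivWithinAt θ (F s) (Icc 0 1) s := fun s hs =>
    (hΘd s).hasDerivWithinAt.congr hΘ (hΘ s hs)
  have hdw1 : ∀ s ∈ Icc (0:ℝ) 1, derivWithin θ (Icc 0 1) s = F s := fun s hs =>
    (hd1 s hs).derivWithin (hud s hs)
  have hdw2 : ∀ s ∈ Icc (0:ℝ) 1, derivWithin F (Icc 0 1) s = -(b * (1 - s) * Real.cos (θ s)) :=
    fun s hs => (hFd s hs).hasDerivWithinAt.derivWithin (hud s hs)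
  have hsmooth : ∀ n : ℕ, ContDiffOn ℝ n θ (Icc 0 1) ∧ ContDiffOn ℝ n F (Icc 0 1) := by
    intro n
    induction n with
    | zero =>
      simp only [Nat.cast_zero, contDiffOn_zero]
      exact ⟨fun s hs => (hd1 s hs).continuousWithinAt,
        fun s hs => (hFd s hs).continuousAt.continuousWithinAt⟩
    | succ n ih =>
      obtain ⟨i1, i2⟩ := ih
      push_cast
      rw [contDiffOn_succ_iff_derivWithin hud, contDiffOn_succ_iff_derivWithin hud]
      refine ⟨⟨fun s hs => (hd1 s hs).differentiableWithinAt, by simp, i2.congr hdw1⟩,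
        ⟨fun s hs => (hFd s hs).differentiableAt.differentiableWithinAt, by simp, ?_⟩⟩
      refine ContDiffOn.congr ?_ hdw2
      have : ContDiffOn ℝ n (fun s : ℝ => b * (1 - s)) (Icc 0 1) :=
        (contDiff_const.mul (contDiff_const.sub contDiff_id)).contDiffOn
      exact (this.mul i1.cos).neg
  have hbound : ∀ s ∈ Icc (0:ℝ) 1, 0 ≤ θ s ∧ θ s < π / 2 := fun s hs => by
    refine ⟨?_, (abs_lt.1 (hθabs s hs)).2⟩
    have := hmono.monotoneOn z0 hs hs.1
    rwa [hΘ 0 z0, hΘ0] at this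
  refine ⟨contDiffOn_infty.2 fun n => (hsmooth n).1, hmono, fun s hs => ?_, hbound, (hbound 1 z1).2⟩
  have hs' : s ∈ Icc (0:ℝ) 1 := ⟨hs.1, hs.2.le⟩
  rw [derivWithin_congr hdw1 (hdw1 s hs'), hdw2 s hs']
  exact hneg s hs
end

section
/- For each b > 0 there is at most one solution θ of θ'' = −b(1−s) cos θ with θ(0)=0, θ'(1)=0 whose range is contained in [0, π/2). Consequently, the global minimizer of E is unique and there are no other stationary points with range in [0, π/2). -/
open MeasureTheory Real Set

lemma ac_lip {f u : ℝ → ℝ} (hf : ∀ x y, |f x - f y| ≤ |x - y|) {a b : ℝ}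
    (hu : AbsolutelyContinuousOnInterval u a b) :
    AbsolutelyContinuousOnInterval (fun s => f (u s)) a b := by
  apply squeeze_zero (fun t ↦ ?_) (fun t ↦ ?_) hu
  · exact Finset.sum_nonneg (fun i hi ↦ by positivity)
  · exact Finset.sum_le_sum (fun i _ => by simpa [Real.dist_eq] using hf _ _)

lemma deriv_lip {f u : ℝ → ℝ} (hf : ∀ x y, |f x - f y| ≤ |x - y|) {x d : ℝ}
    (hu : HasDerivAt u d x) : |deriv (fun s => f (u s)) x| ≤ |d| := by
  refine le_of_forall_pos_le_add (fun ε hε => ?_)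
  have h := (hasDerivAt_iff_isLittleO.1 hu).def hε
  have := norm_deriv_le_of_lip' (f := fun s => f (u s)) (x₀ := x) (C := |d| + ε) (by positivity) ?_
  · simpa using this
  filter_upwards [h] with y hy
  simp only [Real.norm_eq_abs, smul_eq_mul] at hy ⊢
  refine (hf _ _).trans ?_
  have h1 : |u y - u x| ≤ |u y - u x - (y - x) * d| + |(y - x) * d| := by
    have := abs_add_le (u y - u x - (y - x) * d) ((y - x) * d)
    simpa using this
  rw [abs_mul] at h1
  nlinarith

lemma trunc {f θ θ' : ℝ → ℝ} (hf : ∀ x y, |f x - f y| ≤ |x - y|) (hf0 : f 0 = 0)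
    (h : InH101 θ θ') : ∃ g, InH101 (fun s => f (θ s)) g ∧
      (∫ s in (0:ℝ)..1, (g s)^2) ≤ ∫ s in (0:ℝ)..1, (θ' s)^2 := by
  obtain ⟨h1, h2, h3⟩ := h
  set u : ℝ → ℝ := fun s => ∫ t in (0:ℝ)..s, θ' t with hu
  have hac : AbsolutelyContinuousOnInterval u 0 1 :=
    h2.absolutelyContinuousOnInterval_intervalIntegral (by simp)
  have hac2 := ac_lip hf hac
  have hg := hac2.intervalIntegrable_deriv
  set g := deriv (fun s => f (u s)) with hgdef
  have hae : ∀ᵐ x, x ∈ uIcc (0:ℝ) 1 → |g x| ≤ |θ' x| := by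
    filter_upwards [h2.ae_hasDerivAt_integral] with x hx hx1
    exact deriv_lip hf (hx hx1 0 (by simp))
  have hsq : IntervalIntegrable (fun s => (g s)^2) volume 0 1 := by
    refine h3.mono_fun ?_ ?_
    · exact (hg.aestronglyMeasurable_restrict_uIoc).pow 2
    · refine (ae_restrict_iff' measurableSet_uIoc).2 ?_
      filter_upwards [hae] with x hx hx1
      have := sq_le_sq.2 (hx (uIoc_subset_uIcc hx1))
      simpa using this
  refine ⟨g, ⟨?_, hg, hsq⟩, ?_⟩
  · intro s hs
    have hm : AbsolutelyContinuousOnInterval (fun s => f (u s)) 0 s :=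
      hac2.mono (by rw [uIcc_of_le hs.1, uIcc_of_le zero_le_one]; exact Icc_subset_Icc_right hs.2)
    have := hm.integral_deriv_eq_sub
    simp only [hgdef]
    rw [this]
    simp [hu, hf0, h1 s hs]
  · refine intervalIntegral.integral_mono_ae_restrict zero_le_one hsq h3 ?_
    refine (ae_restrict_iff' measurableSet_Icc).2 ?_
    filter_upwards [hae] with x hx hx1
    exact sq_le_sq.2 (hx (by rwa [uIcc_of_le zero_le_one]))

lemma InH101.zero {θ θ' : ℝ → ℝ} (h : InH101 θ θ') : θ 0 = 0 := by
  simpa using h.1 0 (by simp)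

lemma InH101.contSin {θ θ' : ℝ → ℝ} (h : InH101 θ θ') :
    ContinuousOn (fun s => (1 - s) * Real.sin (θ s)) (Icc 0 1) :=
  (continuous_const.sub continuous_id).continuousOn.mul
    (Real.continuous_sin.comp_continuousOn h.cont)

lemma InH101.intSin {θ θ' : ℝ → ℝ} (h : InH101 θ θ') :
    IntervalIntegrable (fun s => (1 - s) * Real.sin (θ s)) volume 0 1 := by
  apply ContinuousOn.intervalIntegrable
  rw [uIcc_of_le zero_le_one]
  exact h.contSin

noncomputable def cut (x : ℝ) : ℝ := min |x| (π / 2)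

lemma cut_lip (x y : ℝ) : |cut x - cut y| ≤ |x - y| := by
  unfold cut
  exact (abs_min_sub_min_le_max _ _ _ _).trans (by simp [abs_abs_sub_abs_le])

lemma sin_le_cut (x : ℝ) : Real.sin x ≤ Real.sin (cut x) := by
  unfold cut
  rcases le_total |x| (π/2) with h | h
  · rw [min_eq_left h]
    have := abs_le.1 h
    exact Real.sin_le_sin_of_le_of_le_pi_div_two (by linarith) h (le_abs_self x)
  · rw [min_eq_right h, Real.sin_pi_div_two]
    exact Real.sin_le_one x

lemma minimizer_range {b : ℝ} (hb : 0 < b) {θ θ' : ℝ → ℝ} (h : IsMinimizer b θ θ') :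
    ∀ s ∈ Ico (0:ℝ) 1, θ s ∈ Icc 0 (π / 2) := by
  obtain ⟨hH, hmin⟩ := h
  have hpi := Real.pi_pos
  obtain ⟨g, hg, hle⟩ := trunc cut_lip (by simp only [cut, abs_zero]; exact min_eq_left (by positivity)) hH
  have hE := hmin _ _ hg
  unfold energy at hE
  have key : ∀ s ∈ Ico (0:ℝ) 1, Real.sin (cut (θ s)) = Real.sin (θ s) := by
    intro s hs
    by_contra hne
    have hlt := lt_of_le_of_ne (sin_le_cut (θ s)) (Ne.symm hne)
    have hs1 : 0 < 1 - s := by linarith [hs.2]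
    have := intervalIntegral.integral_lt_integral_of_continuousOn_of_le_of_exists_lt
      zero_lt_one hH.contSin hg.contSin
      (fun x hx => mul_le_mul_of_nonneg_left (sin_le_cut (θ x)) (by linarith [hx.2]))
      ⟨s, ⟨hs.1, hs.2.le⟩, mul_lt_mul_of_pos_left hlt hs1⟩
    have := mul_lt_mul_of_pos_left this hb
    linarith
  have ivt : ∀ s ∈ Ico (0:ℝ) 1, ∀ y ∈ uIcc 0 (θ s), Real.sin (cut y) = Real.sin y := by
    intro s hs y hy
    have hc : ContinuousOn θ (uIcc 0 s) := by
      rw [uIcc_of_le hs.1]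
      exact hH.cont.mono (Icc_subset_Icc_right hs.2.le)
    have := intermediate_value_uIcc hc
    rw [hH.zero] at this
    obtain ⟨t, ht, rfl⟩ := this hy
    rw [uIcc_of_le hs.1] at ht
    exact key t ⟨ht.1, ht.2.trans_lt hs.2⟩
  intro s hs
  refine ⟨?_, ?_⟩
  · by_contra hn
    push Not at hn
    have := ivt s hs (max (θ s) (-(π/4))) (by
      rw [uIcc_of_ge hn.le]; exact ⟨le_max_left _ _, max_le hn.le (by linarith)⟩)
    set y := max (θ s) (-(π/4)) with hy
    have hy0 : y < 0 := max_lt hn (by linarith)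
    have hy1 : -(π/4) ≤ y := le_max_right _ _
    unfold cut at this
    rw [abs_of_neg hy0, min_eq_left (by linarith), Real.sin_neg] at this
    have := Real.sin_neg_of_neg_of_neg_pi_lt hy0 (by linarith)
    linarith
  · by_contra hn
    push Not at hn
    have := ivt s hs (min (θ s) π) (by
      rw [uIcc_of_le (by linarith)]; exact ⟨le_min (by linarith) hpi.le, min_le_left _ _⟩)
    set y := min (θ s) π with hy
    have hy0 : π/2 < y := lt_min hn (by linarith)
    have hy1 : y ≤ π := min_le_right _ _
    unfold cut at this
    rw [abs_of_pos (by linarith), min_eq_right hy0.le, Real.sin_pi_div_two] at this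
    have h2 : Real.cos (y - π/2) = Real.cos 0 := by
      rw [Real.cos_sub_pi_div_two, Real.cos_zero, this]
    have := Real.injOn_cos ⟨by linarith, by linarith⟩ ⟨le_refl 0, hpi.le⟩ h2
    linarith

lemma minimizer_unique {b : ℝ} (hb : 0 < b) {θ θ' ψ ψ' : ℝ → ℝ} (h : IsMinimizer b θ θ')
    (k : IsMinimizer b ψ ψ') : EqOn θ ψ (Icc 0 1) := by
  have hr := minimizer_range hb h
  have kr := minimizer_range hb k
  obtain ⟨hH, hmin⟩ := h
  obtain ⟨kH, kmin⟩ := k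
  have hpi := Real.pi_pos
  have hab : IntervalIntegrable (fun s => θ' s * ψ' s) volume 0 1 := by
    refine (hH.2.2.add kH.2.2).mono_fun
      (hH.2.1.aestronglyMeasurable_restrict_uIoc.mul kH.2.1.aestronglyMeasurable_restrict_uIoc) ?_
    refine Filter.Eventually.of_forall (fun x => ?_)
    simp only [Real.norm_eq_abs]
    rw [abs_of_nonneg (by positivity : 0 ≤ θ' x ^2 + ψ' x ^2)]
    exact abs_le.2 ⟨by nlinarith [sq_nonneg (θ' x + ψ' x)], by nlinarith [sq_nonneg (θ' x - ψ' x)]⟩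
  have hd : IntervalIntegrable (fun s => (θ' s - ψ' s)^2) volume 0 1 := by
    have := (hH.2.2.add kH.2.2).sub (hab.const_mul 2)
    refine this.congr ?_
    exact fun x _ => by ring
  have hm2 : IntervalIntegrable (fun s => (1/2 * (θ' s + ψ' s))^2) volume 0 1 := by
    have := ((hH.2.2.add kH.2.2).add (hab.const_mul 2)).const_mul (1/4)
    refine this.congr ?_
    exact fun x _ => by ring
  have hm : InH101 (fun s => 1/2 * (θ s + ψ s)) (fun s => 1/2 * (θ' s + ψ' s)) := by
    refine ⟨fun s hs => ?_, (hH.2.1.add kH.2.1).const_mul _, hm2⟩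
    have hsub : uIcc 0 s ⊆ uIcc (0:ℝ) 1 := by
      rw [uIcc_of_le hs.1, uIcc_of_le zero_le_one]; exact Icc_subset_Icc_right hs.2
    show 1/2 * (θ s + ψ s) = _
    rw [intervalIntegral.integral_const_mul, intervalIntegral.integral_add
      (hH.2.1.mono_set hsub) (kH.2.1.mono_set hsub), hH.1 s hs, kH.1 s hs]
  have e1 := hmin _ _ hm
  have e2 := kmin _ _ hm
  unfold energy at e1 e2
  beta_reduce at e1 e2
  have i1 : (∫ s in (0:ℝ)..1, (1/2 * (θ' s + ψ' s))^2) =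
      1/2 * (∫ s in (0:ℝ)..1, (θ' s)^2) + 1/2 * (∫ s in (0:ℝ)..1, (ψ' s)^2)
        - 1/4 * ∫ s in (0:ℝ)..1, (θ' s - ψ' s)^2 := by
    rw [← intervalIntegral.integral_const_mul, ← intervalIntegral.integral_const_mul,
      ← intervalIntegral.integral_const_mul, ← intervalIntegral.integral_add
      (hH.2.2.const_mul _) (kH.2.2.const_mul _), ← intervalIntegral.integral_sub
      ((hH.2.2.const_mul _).add (kH.2.2.const_mul _)) (hd.const_mul _)]
    congr 1
    ext x
    ring
  have i2 : 1/2 * (∫ s in (0:ℝ)..1, (1 - s) * Real.sin (θ s)) +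
      1/2 * (∫ s in (0:ℝ)..1, (1 - s) * Real.sin (ψ s)) ≤
      ∫ s in (0:ℝ)..1, (1 - s) * Real.sin (1/2 * (θ s + ψ s)) := by
    rw [← intervalIntegral.integral_const_mul, ← intervalIntegral.integral_const_mul,
      ← intervalIntegral.integral_add (hH.intSin.const_mul _) (kH.intSin.const_mul _)]
    refine intervalIntegral.integral_mono_on zero_le_one
      ((hH.intSin.const_mul _).add (kH.intSin.const_mul _)) hm.intSin (fun x hx => ?_)
    rcases hx.2.eq_or_lt with rfl | hx1
    · simp
    have a1 := hr x ⟨hx.1, hx1⟩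
    have a2 := kr x ⟨hx.1, hx1⟩
    have := strictConcaveOn_sin_Icc.concaveOn.2
      (show θ x ∈ Icc 0 π from ⟨a1.1, by linarith [a1.2]⟩)
      (show ψ x ∈ Icc 0 π from ⟨a2.1, by linarith [a2.2]⟩)
      (show (0:ℝ) ≤ 1/2 by norm_num) (show (0:ℝ) ≤ 1/2 by norm_num) (by norm_num)
    simp only [smul_eq_mul] at this
    rw [← mul_add (1/2) (θ x) (ψ x)] at this
    have h0 : 0 ≤ 1 - x := by linarith
    nlinarith
  have i3 := mul_le_mul_of_nonneg_left i2 hb.le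
  have i4 : (∫ s in (0:ℝ)..1, (θ' s - ψ' s)^2) ≤ 0 := by
    rw [i1] at e1 e2
    linarith
  have i5 : (∫ s in (0:ℝ)..1, (θ' s - ψ' s)^2) = 0 :=
    le_antisymm i4 (intervalIntegral.integral_nonneg zero_le_one (fun x _ => sq_nonneg _))
  have i6 := (intervalIntegral.integral_eq_zero_iff_of_le_of_nonneg_ae zero_le_one
    (Filter.Eventually.of_forall (fun x => sq_nonneg _)) hd).1 i5
  have i7 : ∀ᵐ x, x ∈ Ioc (0:ℝ) 1 → θ' x = ψ' x := by
    have := (ae_restrict_iff' measurableSet_Ioc).1 i6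
    filter_upwards [this] with x hx hx1
    have := hx hx1
    simp only [Pi.zero_apply] at this
    have := pow_eq_zero_iff (two_ne_zero) |>.1 this
    linarith
  intro s hs
  rw [hH.1 s hs, kH.1 s hs]
  refine intervalIntegral.integral_congr_ae ?_
  filter_upwards [i7] with x hx hx1
  rw [uIoc_of_le hs.1] at hx1
  exact hx ⟨hx1.1, hx1.2.trans hs.2⟩

lemma classical_unique {b : ℝ} (hb : 0 < b) {θ₁ θ₂ : ℝ → ℝ} (h₁ : ClassicalSolution b θ₁)
    (h₂ : ClassicalSolution b θ₂)
    (r₁ : ∀ s ∈ Set.Icc (0:ℝ) 1, θ₁ s ∈ Set.Ico 0 (π / 2))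
    (r₂ : ∀ s ∈ Set.Icc (0:ℝ) 1, θ₂ s ∈ Set.Ico 0 (π / 2)) :
    Set.EqOn θ₁ θ₂ (Set.Icc 0 1) := by
  obtain ⟨c1, z1, d1, o1⟩ := h₁
  obtain ⟨c2, z2, d2, o2⟩ := h₂
  have hpi := Real.pi_pos
  have D : ∀ θ : ℝ → ℝ, ContDiff ℝ 2 θ → (∀ x, HasDerivAt θ (deriv θ x) x) ∧
      ∀ x, HasDerivAt (deriv θ) (deriv (deriv θ) x) x := by
    intro θ c
    have c' : ContDiff ℝ (1 + 1) θ := by norm_num; exact c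
    have := (contDiff_succ_iff_deriv.1 c').2.2
    exact ⟨fun x => (c.differentiable (by norm_num) x).hasDerivAt,
      fun x => (this.differentiable (by norm_num) x).hasDerivAt⟩
  obtain ⟨p1, q1⟩ := D _ c1
  obtain ⟨p2, q2⟩ := D _ c2
  have hu : ∀ x, HasDerivAt (fun s => θ₁ s - θ₂ s) (deriv θ₁ x - deriv θ₂ x) x :=
    fun x => (p1 x).sub (p2 x)
  have hv : ∀ x, HasDerivAt (fun s => deriv θ₁ s - deriv θ₂ s)
    (deriv (deriv θ₁) x - deriv (deriv θ₂) x) x := fun x => (q1 x).sub (q2 x)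
  have hw := fun x => (hu x).mul (hv x)
  have hmono : MonotoneOn (fun s => (θ₁ s - θ₂ s) * (deriv θ₁ s - deriv θ₂ s)) (Icc 0 1) := by
    refine monotoneOn_of_hasDerivWithinAt_nonneg (convex_Icc 0 1)
      (fun x _ => (hw x).continuousAt.continuousWithinAt)
      (fun x _ => (hw x).hasDerivWithinAt) (fun x hx => ?_)
    have hx := interior_subset hx
    rw [o1 x hx, o2 x hx]
    have a1 := r₁ x hx
    have a2 := r₂ x hx
    have hs : 0 ≤ b * (1 - x) := mul_nonneg hb.le (by linarith [hx.2])
    have hc : (θ₁ x - θ₂ x) * (Real.cos (θ₁ x) - Real.cos (θ₂ x)) ≤ 0 := by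
      rcases le_total (θ₁ x) (θ₂ x) with h | h
      · have := Real.cos_le_cos_of_nonneg_of_le_pi a1.1 (by linarith [a2.2]) h
        nlinarith
      · have := Real.cos_le_cos_of_nonneg_of_le_pi a2.1 (by linarith [a1.2]) h
        nlinarith
    nlinarith [sq_nonneg (deriv θ₁ x - deriv θ₂ x)]
  have hz : ∀ x ∈ Icc (0:ℝ) 1, (θ₁ x - θ₂ x) * (deriv θ₁ x - deriv θ₂ x) = 0 := by
    intro x hx
    have l := hmono (left_mem_Icc.2 zero_le_one) hx hx.1
    have u := hmono hx (right_mem_Icc.2 zero_le_one) hx.2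
    simp only [z1, z2, d1, d2, sub_self, zero_mul, mul_zero] at l u
    exact le_antisymm u l
  have hsq := fun x => (hu x).mul (hu x)
  intro x hx
  have := constant_of_has_deriv_right_zero
    (f := fun s => (θ₁ s - θ₂ s) * (θ₁ s - θ₂ s)) (a := 0) (b := 1)
    (fun x _ => (hsq x).continuousAt.continuousWithinAt)
    (fun x hx => by
      have := (hsq x).hasDerivWithinAt (s := Ici x)
      have e := hz x ⟨hx.1, hx.2.le⟩
      rwa [mul_comm (deriv θ₁ x - deriv θ₂ x), e, add_zero] at this) x hx
  simp only [z1, z2, sub_self, mul_zero] at this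
  have := mul_self_eq_zero.1 this
  linarith

/-- for each `b > 0` there is at most one classical solution with
range in `[0, π/2)`; consequently the global minimizer of `E` is unique. -/
theorem unique_solution_range_in_first_quadrant (b : ℝ) (hb : 0 < b) :
    (∀ θ₁ θ₂ : ℝ → ℝ, ClassicalSolution b θ₁ → ClassicalSolution b θ₂ →
      (∀ s ∈ Set.Icc (0:ℝ) 1, θ₁ s ∈ Set.Ico 0 (π / 2)) →
      (∀ s ∈ Set.Icc (0:ℝ) 1, θ₂ s ∈ Set.Ico 0 (π / 2)) →
      Set.EqOn θ₁ θ₂ (Set.Icc 0 1)) ∧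
    (∀ θ θ' ψ ψ' : ℝ → ℝ, IsMinimizer b θ θ' → IsMinimizer b ψ ψ' →
      Set.EqOn θ ψ (Set.Icc 0 1)) := by
  exact ⟨fun _ _ h₁ h₂ r₁ r₂ => classical_unique hb h₁ h₂ r₁ r₂,
    fun _ _ _ _ h k => minimizer_unique hb h k⟩
end

section
/- The map b ↦ θ_b assigning to each b > 0 the unique global minimizer of E_b is continuous from (0,∞) into H¹([0,1]): if b → b₀ then ‖θ_b − θ_{b₀}‖_{H¹} → 0. -/
open MeasureTheory Real Set

open intervalIntegral in
theorem inH_continuousOn {θ θ' : ℝ → ℝ} (h : InH101 θ θ') : ContinuousOn θ (Set.Icc 0 1) := by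
  have h1 : ContinuousOn (fun s => ∫ t in (0:ℝ)..s, θ' t) (Set.Icc 0 1) := by
    have := intervalIntegral.continuousOn_primitive_interval (μ := volume) (f := θ') (a := 0) (b := 1)
      (by
        have := h.2.1
        rw [intervalIntegrable_iff_integrableOn_Icc_of_le zero_le_one] at this
        rwa [uIcc_of_le zero_le_one])
    rwa [uIcc_of_le zero_le_one] at this
  exact h1.congr h.1

noncomputable def foldAngle (x : ℝ) : ℝ := ‖(x : AddCircle Real.pi)‖

theorem foldAngle_lip (x y : ℝ) : |foldAngle x - foldAngle y| ≤ |x - y| := by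
  unfold foldAngle
  refine (abs_norm_sub_norm_le _ _).trans ?_
  rw [← AddCircle.coe_sub, AddCircle.norm_eq]
  have h := round_le (Real.pi⁻¹ * (x - y)) 0
  have hp := Real.pi_pos
  have e1 : x - y - round (Real.pi⁻¹ * (x - y)) * Real.pi
      = Real.pi * (Real.pi⁻¹ * (x - y) - round (Real.pi⁻¹ * (x - y))) := by
    field_simp
  have e2 : x - y = Real.pi * (Real.pi⁻¹ * (x - y) - (0:ℤ)) := by
    push_cast; field_simp; ring
  rw [e1, abs_mul]
  conv_rhs => rw [e2, abs_mul]
  gcongr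

theorem sin_foldAngle (x : ℝ) : Real.sin (foldAngle x) = |Real.sin x| := by
  have hp := Real.pi_pos
  have h2 : foldAngle x ≤ Real.pi / 2 := by
    have := AddCircle.norm_le_half_period Real.pi (x := (x : AddCircle Real.pi)) hp.ne'
    rwa [abs_of_pos hp] at this
  have h0 : 0 ≤ foldAngle x := norm_nonneg _
  rw [← abs_of_nonneg (Real.sin_nonneg_of_nonneg_of_le_pi h0 (by linarith))]
  unfold foldAngle
  rw [AddCircle.norm_eq]
  set y := x - round (Real.pi⁻¹ * x) * Real.pi with hy
  have h3 : abs (Real.sin (abs y)) = abs (Real.sin y) := by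
    rcases abs_choice y with h | h <;> rw [h]
    rw [Real.sin_neg, abs_neg]
  rw [h3, hy, Real.sin_sub_int_mul_pi, abs_mul, abs_zpow]
  simp

theorem fold_inH {θ θ' : ℝ → ℝ} (h : InH101 θ θ') :
    ∃ φ φ', InH101 φ φ' ∧ (∀ s ∈ Set.Icc (0:ℝ) 1, φ s = foldAngle (θ s)) ∧
      (∫ s in (0:ℝ)..1, (φ' s)^2) ≤ ∫ s in (0:ℝ)..1, (θ' s)^2 := by
  let G : ℝ → ℝ := fun s => ∫ t in (0:ℝ)..s, θ' t
  let Φ : ℝ → ℝ := fun s => foldAngle (G s)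
  have hG : AbsolutelyContinuousOnInterval G 0 1 :=
    h.2.1.absolutelyContinuousOnInterval_intervalIntegral (c := 0) (by simp)
  have hΦ : AbsolutelyContinuousOnInterval Φ 0 1 := by
    rw [absolutelyContinuousOnInterval_iff] at hG ⊢
    intro ε hε
    obtain ⟨δ, hδ, H⟩ := hG ε hε
    refine ⟨δ, hδ, fun E hE hs => lt_of_le_of_lt ?_ (H E hE hs)⟩
    refine Finset.sum_le_sum fun i _ => ?_
    simp only [Real.dist_eq]
    exact foldAngle_lip _ _
  have hbd : ∀ᵐ x, x ∈ Set.uIcc (0:ℝ) 1 → (deriv Φ x)^2 ≤ (θ' x)^2 := by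
    filter_upwards [hΦ.ae_differentiableAt, h.2.1.ae_hasDerivAt_integral] with x h1 h2 hx
    have a1 := hasDerivAt_iff_tendsto_slope.1 (h1 hx).hasDerivAt
    have a2 := hasDerivAt_iff_tendsto_slope.1 (h2 hx 0 (by simp))
    rw [sq_le_sq]
    refine le_of_tendsto_of_tendsto a1.abs a2.abs ?_
    refine Filter.Eventually.of_forall fun y => ?_
    simp only [slope_def_field, abs_div]
    exact div_le_div_of_nonneg_right (foldAngle_lip _ _) (abs_nonneg _)
  have hint : IntervalIntegrable (fun s => (deriv Φ s)^2) volume 0 1 := by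
    refine h.2.2.mono_fun ((measurable_deriv Φ).pow_const 2).aestronglyMeasurable ?_
    rw [Filter.EventuallyLE, ae_restrict_iff' measurableSet_uIoc]
    filter_upwards [hbd] with x hx hx'
    simp only [norm_pow, Real.norm_eq_abs, sq_abs]
    exact hx (uIoc_subset_uIcc hx')
  refine ⟨Φ, deriv Φ, ⟨?_, hΦ.intervalIntegrable_deriv, hint⟩, ?_, ?_⟩
  · intro s hs
    have hm : AbsolutelyContinuousOnInterval Φ 0 s := hΦ.mono (by
      rw [uIcc_of_le hs.1, uIcc_of_le zero_le_one]
      exact Icc_subset_Icc le_rfl hs.2)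
    rw [hm.integral_deriv_eq_sub]
    simp [Φ, G, foldAngle]
  · intro s hs
    simp only [Φ, G, h.1 s hs]
  · refine intervalIntegral.integral_mono_ae_restrict zero_le_one hint h.2.2 ?_
    rw [Filter.EventuallyLE, ae_restrict_iff' measurableSet_Icc]
    filter_upwards [hbd] with x hx hx'
    exact hx (by rwa [uIcc_of_le zero_le_one])

theorem inH_sinInt {θ θ' : ℝ → ℝ} (h : InH101 θ θ') :
    ContinuousOn (fun s => (1 - s) * Real.sin (θ s)) (Set.Icc 0 1) :=
  (by fun_prop : ContinuousOn (fun s : ℝ => 1 - s) (Set.Icc 0 1)).mul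
    (Real.continuous_sin.comp_continuousOn (inH_continuousOn h))

theorem min_sin_nonneg {b : ℝ} (hb : 0 < b) {θ θ' : ℝ → ℝ} (h : IsMinimizer b θ θ') :
    ∀ s ∈ Set.Ico (0:ℝ) 1, 0 ≤ Real.sin (θ s) := by
  obtain ⟨φ, φ', hφ, hf, hle⟩ := fold_inH h.1
  have hE := h.2 φ φ' hφ
  unfold energy at hE
  have c1 := inH_sinInt h.1
  have c2 := inH_sinInt hφ
  have i1 := c1.intervalIntegrable_of_Icc (μ := volume) zero_le_one
  have i2 := c2.intervalIntegrable_of_Icc (μ := volume) zero_le_one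
  have hI : (∫ s in (0:ℝ)..1, (1 - s) * Real.sin (φ s)) ≤ ∫ s in (0:ℝ)..1, (1 - s) * Real.sin (θ s) := by
    by_contra! hc
    nlinarith
  intro s hs
  by_contra! hneg
  have hpos := intervalIntegral.integral_pos (zero_lt_one) (c2.fun_sub c1) (by
      intro x hx
      have hx' : x ∈ Set.Icc (0:ℝ) 1 := ⟨hx.1.le, hx.2⟩
      simp only [hf x hx', sin_foldAngle]
      have := le_abs_self (Real.sin (θ x))
      have := hx.2
      nlinarith) ⟨s, ⟨hs.1, hs.2.le⟩, by
      simp only [hf s ⟨hs.1, hs.2.le⟩, sin_foldAngle]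
      have := abs_pos_of_neg hneg
      have := hs.2
      nlinarith⟩
  rw [intervalIntegral.integral_sub i2 i1] at hpos
  linarith

theorem min_range {b : ℝ} (hb : 0 < b) {θ θ' : ℝ → ℝ} (h : IsMinimizer b θ θ') :
    ∀ s ∈ Set.Ico (0:ℝ) 1, θ s ∈ Set.Icc 0 Real.pi := by
  intro s hs
  have hsin := min_sin_nonneg hb h
  have hp := Real.pi_pos
  have hc : ContinuousOn θ (Set.uIcc 0 s) := (inH_continuousOn h.1).mono (by
    rw [uIcc_of_le hs.1]; exact Icc_subset_Icc le_rfl hs.2.le)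
  have h0 : θ 0 = 0 := by rw [h.1.1 0 (by simp)]; simp
  have ivt := intermediate_value_uIcc hc
  rw [h0] at ivt
  constructor
  · by_contra! hlt
    have : max (θ s) (-(Real.pi/2)) ∈ Set.uIcc 0 (θ s) := by
      rw [uIcc_of_ge hlt.le]
      exact ⟨le_max_left _ _, max_le hlt.le (by linarith)⟩
    obtain ⟨t, ht, he⟩ := ivt this
    rw [uIcc_of_le hs.1] at ht
    have h1 := hsin t ⟨ht.1, ht.2.trans_lt hs.2⟩
    rw [he] at h1
    have h2 := Real.sin_neg_of_neg_of_neg_pi_lt (x := max (θ s) (-(Real.pi/2)))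
      (max_lt hlt (by linarith)) (lt_max_of_lt_right (by linarith))
    linarith
  · by_contra! hlt
    have : min (θ s) (3 * Real.pi/2) ∈ Set.uIcc 0 (θ s) := by
      rw [uIcc_of_le (hp.trans hlt).le]
      exact ⟨le_min (hp.trans hlt).le (by linarith), min_le_left _ _⟩
    obtain ⟨t, ht, he⟩ := ivt this
    rw [uIcc_of_le hs.1] at ht
    have h1 := hsin t ⟨ht.1, ht.2.trans_lt hs.2⟩
    rw [he] at h1
    have h3 : Real.pi < min (θ s) (3 * Real.pi/2) := lt_min hlt (by linarith)
    have h4 : min (θ s) (3 * Real.pi/2) ≤ 3 * Real.pi/2 := min_le_right _ _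
    have h2 := Real.sin_pos_of_pos_of_lt_pi (x := min (θ s) (3 * Real.pi/2) - Real.pi)
      (by linarith) (by linarith)
    rw [Real.sin_sub_pi] at h2
    linarith

theorem inH_memLp {θ θ' : ℝ → ℝ} (h : InH101 θ θ') :
    MemLp θ' 2 (volume.restrict (Set.Ioc 0 1)) := by
  have h1 := h.2.1.1.aestronglyMeasurable
  exact (memLp_two_iff_integrable_sq h1).2 h.2.2.1

theorem inH_mul {θ θ' ψ ψ' : ℝ → ℝ} (h : InH101 θ θ') (k : InH101 ψ ψ') :
    IntervalIntegrable (fun s => θ' s * ψ' s) volume 0 1 := by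
  rw [intervalIntegrable_iff_integrableOn_Ioc_of_le zero_le_one]
  exact (inH_memLp h).integrable_mul (inH_memLp k)

theorem inH_comb {θ θ' ψ ψ' : ℝ → ℝ} (h : InH101 θ θ') (k : InH101 ψ ψ') (c d : ℝ) :
    InH101 (fun s => c * θ s + d * ψ s) (fun s => c * θ' s + d * ψ' s) := by
  refine ⟨fun s hs => ?_, (h.2.1.const_mul c).add (k.2.1.const_mul d), ?_⟩
  · have hsub : Set.uIcc 0 s ⊆ Set.uIcc (0:ℝ) 1 := by
      rw [uIcc_of_le hs.1, uIcc_of_le zero_le_one]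
      exact Icc_subset_Icc le_rfl hs.2
    rw [intervalIntegral.integral_add ((h.2.1.mono_set hsub).const_mul c)
      ((k.2.1.mono_set hsub).const_mul d)]
    simp only [intervalIntegral.integral_const_mul, h.1 s hs, k.1 s hs]
  · have := ((h.2.2.const_mul (c^2)).add ((inH_mul h k).const_mul (2*c*d))).add
      (k.2.2.const_mul (d^2))
    refine this.congr_ae (Filter.Eventually.of_forall fun s => ?_)
    ring

theorem inH_poincare {θ θ' : ℝ → ℝ} (h : InH101 θ θ') :
    (∫ s in (0:ℝ)..1, (θ s)^2) ≤ ∫ s in (0:ℝ)..1, (θ' s)^2 := by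
  have key : ∀ s ∈ Set.Icc (0:ℝ) 1, (θ s)^2 ≤ ∫ s in (0:ℝ)..1, (θ' s)^2 := by
    intro s hs
    have hsub : Set.uIcc 0 s ⊆ Set.uIcc (0:ℝ) 1 := by
      rw [uIcc_of_le hs.1, uIcc_of_le zero_le_one]
      exact Icc_subset_Icc le_rfl hs.2
    have i1 := h.2.1.mono_set hsub
    have i2 := h.2.2.mono_set hsub
    set m := θ s with hm
    have e := h.1 s hs
    have h0 : 0 ≤ ∫ t in (0:ℝ)..s, (θ' t - m)^2 :=
      intervalIntegral.integral_nonneg hs.1 fun t _ => sq_nonneg _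
    have e2 : (∫ t in (0:ℝ)..s, (θ' t - m)^2)
        = (∫ t in (0:ℝ)..s, (θ' t)^2) - 2 * m * m + s * m^2 := by
      have : (fun t => (θ' t - m)^2) = fun t => ((θ' t)^2 - (2*m) * θ' t) + m^2 := by
        ext t; ring
      rw [this, intervalIntegral.integral_add (i2.sub (i1.const_mul _)) (by simp),
        intervalIntegral.integral_sub i2 (i1.const_mul _), intervalIntegral.integral_const_mul,
        ← e, ← hm]
      simp
    have e3 : (∫ t in (0:ℝ)..s, (θ' t)^2) ≤ ∫ t in (0:ℝ)..1, (θ' t)^2 :=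
      intervalIntegral.integral_mono_interval le_rfl hs.1 hs.2
        (Filter.Eventually.of_forall fun t => sq_nonneg _) h.2.2
    have := hs.2
    nlinarith [sq_nonneg m]
  have c := ((inH_continuousOn h).pow 2).intervalIntegrable_of_Icc (μ := volume) zero_le_one
  have := intervalIntegral.integral_mono_on zero_le_one c (by simp) key
  simpa using this

theorem sinInt_bound {θ θ' : ℝ → ℝ} (h : InH101 θ θ') :
    |∫ s in (0:ℝ)..1, (1 - s) * Real.sin (θ s)| ≤ 1 := by
  have := intervalIntegral.norm_integral_le_of_norm_le_const (a := (0:ℝ)) (b := 1) (C := 1)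
    (f := fun s => (1 - s) * Real.sin (θ s)) (by
      intro s hs
      rw [uIoc_of_le zero_le_one] at hs
      rw [Real.norm_eq_abs, abs_mul]
      have h1 : |1 - s| ≤ 1 := by rw [abs_le]; constructor <;> linarith [hs.1, hs.2]
      exact mul_le_one₀ h1 (abs_nonneg _) (Real.abs_sin_le_one _))
  simpa using this

theorem convex_est {b₀ : ℝ} (hb₀ : 0 < b₀) {θ θ' ψ ψ' : ℝ → ℝ} (h : InH101 θ θ')
    (hr : ∀ s ∈ Set.Ico (0:ℝ) 1, θ s ∈ Set.Icc 0 Real.pi) (k : IsMinimizer b₀ ψ ψ') :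
    (∫ s in (0:ℝ)..1, (θ' s - ψ' s)^2) ≤ 4 * (energy b₀ θ θ' - energy b₀ ψ ψ') := by
  have kr := min_range hb₀ k
  have hm := inH_comb h k.1 (1/2) (1/2)
  have hE := k.2 _ _ hm
  have it := (inH_sinInt h).intervalIntegrable_of_Icc (μ := volume) zero_le_one
  have ip := (inH_sinInt k.1).intervalIntegrable_of_Icc (μ := volume) zero_le_one
  have im := (inH_sinInt hm).intervalIntegrable_of_Icc (μ := volume) zero_le_one
  have hs : (1/2) * (∫ s in (0:ℝ)..1, (1 - s) * Real.sin (θ s))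
      + (1/2) * (∫ s in (0:ℝ)..1, (1 - s) * Real.sin (ψ s))
      ≤ ∫ s in (0:ℝ)..1, (1 - s) * Real.sin (1/2 * θ s + 1/2 * ψ s) := by
    rw [← intervalIntegral.integral_const_mul, ← intervalIntegral.integral_const_mul,
      ← intervalIntegral.integral_add (it.const_mul _) (ip.const_mul _)]
    refine intervalIntegral.integral_mono_on zero_le_one ((it.const_mul _).add (ip.const_mul _)) im ?_
    intro s hs
    rcases hs.2.eq_or_lt with rfl | hlt
    · simp
    · have := strictConcaveOn_sin_Icc.concaveOn.2 (hr s ⟨hs.1, hlt⟩) (kr s ⟨hs.1, hlt⟩)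
        (by norm_num : (0:ℝ) ≤ 1/2) (by norm_num : (0:ℝ) ≤ 1/2) (by norm_num)
      simp only [smul_eq_mul] at this
      nlinarith
  have hq : (∫ s in (0:ℝ)..1, (1/2 * θ' s + 1/2 * ψ' s)^2)
      = (1/2) * (∫ s in (0:ℝ)..1, (θ' s)^2) + (1/2) * (∫ s in (0:ℝ)..1, (ψ' s)^2)
        - (1/4) * ∫ s in (0:ℝ)..1, (θ' s - ψ' s)^2 := by
    have id : IntervalIntegrable (fun s => (θ' s - ψ' s)^2) volume 0 1 := by
      have := (inH_comb h k.1 1 (-1)).2.2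
      simpa [← sub_eq_add_neg] using this
    rw [← intervalIntegral.integral_const_mul, ← intervalIntegral.integral_const_mul,
      ← intervalIntegral.integral_const_mul,
      ← intervalIntegral.integral_add (h.2.2.const_mul _) (k.1.2.2.const_mul _),
      ← intervalIntegral.integral_sub ((h.2.2.const_mul _).add (k.1.2.2.const_mul _))
        (id.const_mul _)]
    congr 1
    ext s
    ring
  unfold energy at *
  rw [hq] at hE
  nlinarith [mul_le_mul_of_nonneg_left hs hb₀.le]

/-- continuity of the minimizer in `b`: if `b → b₀` then
`‖θ_b − θ_{b₀}‖_{H¹} → 0`. -/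
theorem minimizer_continuous_in_b (b₀ : ℝ) (hb₀ : 0 < b₀) :
    ∀ ε > 0, ∃ δ > 0, ∀ b : ℝ, 0 < b → |b - b₀| < δ →
      ∀ θ θ' ψ ψ' : ℝ → ℝ, IsMinimizer b θ θ' → IsMinimizer b₀ ψ ψ' →
        (∫ s in (0:ℝ)..1, (θ s - ψ s)^2) +
          (∫ s in (0:ℝ)..1, (θ' s - ψ' s)^2) < ε := by
  intro ε hε
  refine ⟨ε / 16, by positivity, ?_⟩
  intro b hb hbb θ θ' ψ ψ' h k
  have h1 := convex_est hb₀ h.1 (min_range hb h) k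
  have h2 := inH_poincare (inH_comb h.1 k.1 1 (-1))
  simp only [one_mul, neg_mul, ← sub_eq_add_neg] at h2
  have h3 := h.2 ψ ψ' k.1
  have h4 := abs_le.1 (sinInt_bound h.1)
  have h5 := abs_le.1 (sinInt_bound k.1)
  have h6 : energy b₀ θ θ' - energy b₀ ψ ψ' ≤ 2 * |b - b₀| := by
    unfold energy at *
    set S := ∫ s in (0:ℝ)..1, (1 - s) * Real.sin (θ s)
    set T := ∫ s in (0:ℝ)..1, (1 - s) * Real.sin (ψ s)
    have h7 : (b - b₀) * (S - T) ≤ |b - b₀| * 2 := by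
      refine (le_abs_self _).trans ?_
      rw [abs_mul]
      gcongr
      rw [abs_le]
      constructor <;> linarith [h4.1, h4.2, h5.1, h5.2]
    nlinarith
  linarith
end

section
/- Let θ_b be the global minimizer of E_b, and K_b = θ_b'(0). Then K_b ≥ (b/2)∫₀¹ cos θ_b(s) ds and K_b² ≥ (b/2) sin θ_b(1). Moreover K_b → ∞ as b → ∞. -/
open MeasureTheory Real Set

lemma aux_sin_taylor (x y : ℝ) : Real.sin x + y * Real.cos x - 2 * y ^ 2 ≤ Real.sin (x + y) := by
  have h1 : |Real.sin y - y| ≤ y ^ 2 := by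
    have key : ∀ z : ℝ, 0 ≤ z → |Real.sin z - z| ≤ z ^ 2 := by
      intro z hz
      rcases hz.eq_or_lt with rfl | hz
      · simp
      have a1 := Real.sin_lt hz
      have a2 := Real.sin_gt_sub_cube hz
      have a3 := Real.neg_one_le_sin z
      rw [abs_le]
      refine ⟨?_, by nlinarith⟩
      rcases le_total z 2 with h | h
      · nlinarith [mul_nonneg (sq_nonneg z) (sub_nonneg.2 h)]
      · nlinarith
    rcases le_total 0 y with h | h
    · exact key y h
    · have := key (-y) (by linarith)
      rw [Real.sin_neg, neg_sq] at this
      rwa [← abs_neg, neg_sub', ]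
  have h2 : |Real.cos y - 1| ≤ y ^ 2 / 2 := by
    rw [abs_le]
    constructor
    · linarith [Real.one_sub_sq_div_two_le_cos (x := y)]
    · nlinarith [Real.cos_le_one y, sq_nonneg y]
  have h3 : |Real.sin x * (Real.cos y - 1)| ≤ y ^ 2 / 2 := by
    rw [abs_mul]
    nlinarith [Real.abs_sin_le_one x, abs_nonneg (Real.cos y - 1)]
  have h4 : |Real.cos x * (Real.sin y - y)| ≤ y ^ 2 := by
    rw [abs_mul]
    nlinarith [Real.abs_cos_le_one x, abs_nonneg (Real.sin y - y)]
  rw [Real.sin_add]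
  have h5 := (abs_le.1 h3).1
  have h6 := (abs_le.1 h4).1
  nlinarith [sq_nonneg y]

lemma aux_prim (q : ℝ → ℝ) (hq : Continuous q) (s : ℝ) :
    HasDerivAt (fun s => ∫ t in (0:ℝ)..s, q t) (q s) s :=
  intervalIntegral.integral_hasDerivAt_right (hq.intervalIntegrable _ _)
    (hq.stronglyMeasurableAtFilter _ _) hq.continuousAt

lemma aux_zero (w : ℝ → ℝ) (hw : Continuous w) (h0 : ∀ s ∈ Icc (0:ℝ) 1, 0 ≤ w s)
    (hi : ∫ s in (0:ℝ)..1, w s ≤ 0) : ∀ s ∈ Icc (0:ℝ) 1, w s = 0 := by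
  intro s hs
  by_contra hne
  have : 0 < ∫ s in (0:ℝ)..1, w s :=
    intervalIntegral.integral_pos zero_lt_one hw.continuousOn
      (fun x hx => h0 x ⟨hx.1.le, hx.2⟩) ⟨s, hs, lt_of_le_of_ne (h0 s hs) (Ne.symm hne)⟩
  linarith

/-- Euler–Lagrange equation in integrated form. -/
lemma aux_EL (b : ℝ) (hb : 0 < b) (u q : ℝ → ℝ) (hq : Continuous q)
    (hu : u = fun s => ∫ t in (0:ℝ)..s, q t)
    (hmin : ∀ ψ ψ', InH101 ψ ψ' → energy b u q ≤ energy b ψ ψ') :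
    ∀ s ∈ Icc (0:ℝ) 1, q s = ∫ t in s..1, b * ((1 - t) * Real.cos (u t)) := by
  have hud : ∀ s, HasDerivAt u (q s) s := by
    intro s; rw [hu]; exact aux_prim q hq s
  have huc : Continuous u := continuous_iff_continuousAt.2 fun s => (hud s).continuousAt
  set g : ℝ → ℝ := fun t => b * ((1 - t) * Real.cos (u t)) with hg
  have hgc : Continuous g := by fun_prop
  set P : ℝ → ℝ := fun s => ∫ t in (0:ℝ)..s, g t with hP
  have hPd : ∀ s, HasDerivAt P (g s) s := fun s => aux_prim g hgc s
  have hPc : Continuous P := continuous_iff_continuousAt.2 fun s => (hPd s).continuousAt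
  set w : ℝ → ℝ := fun s => q s - (P 1 - P s) with hw
  have hwc : Continuous w := by fun_prop
  set η : ℝ → ℝ := fun s => ∫ t in (0:ℝ)..s, w t with hη
  have hηd : ∀ s, HasDerivAt η (w s) s := fun s => aux_prim w hwc s
  have hηc : Continuous η := continuous_iff_continuousAt.2 fun s => (hηd s).continuousAt
  have hη0 : η 0 = 0 := by simp [hη]
  have parts : ∫ s in (0:ℝ)..1, ((P 1 - P s) * w s - g s * η s) = 0 := by
    have : ∫ s in (0:ℝ)..1, ((P 1 - P s) * w s - g s * η s)
        = (P 1 - P 1) * η 1 - (P 1 - P 0) * η 0 := by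
      apply intervalIntegral.integral_eq_sub_of_hasDerivAt (f := fun s => (P 1 - P s) * η s)
      · intro s _
        have := ((hPd s).const_sub (P 1)).mul (hηd s)
        refine HasDerivAt.congr_deriv (f := fun s => (P 1 - P s) * η s) this ?_
        ring
      · apply Continuous.intervalIntegrable; fun_prop
    rw [this, hη0]; ring
  set A := ∫ s in (0:ℝ)..1, (w s) ^ 2 with hA
  set C := ∫ s in (0:ℝ)..1, ((w s) ^ 2 / 2 + 2 * (b * ((1 - s) * (η s) ^ 2))) with hC
  have main : ∀ t : ℝ, 0 ≤ t * A + t ^ 2 * C := by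
    intro t
    have hin : InH101 (fun s => u s + t * η s) (fun s => q s + t * w s) := by
      refine ⟨fun s _ => ?_, ?_, ?_⟩
      · rw [intervalIntegral.integral_add (hq.intervalIntegrable _ _)
          ((hwc.const_mul t).intervalIntegrable _ _), intervalIntegral.integral_const_mul, hu]
      · apply Continuous.intervalIntegrable; fun_prop
      · apply Continuous.intervalIntegrable; fun_prop
    have h := hmin _ _ hin
    have e1 : ∀ (v v' : ℝ → ℝ), Continuous v → Continuous v' → energy b v v' =
        ∫ s in (0:ℝ)..1, ((v' s) ^ 2 / 2 - b * ((1 - s) * Real.sin (v s))) := by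
      intro v v' hv hv'
      rw [energy, intervalIntegral.integral_sub, intervalIntegral.integral_const_mul,
        intervalIntegral.integral_div]
      · ring
      · apply Continuous.intervalIntegrable; fun_prop
      · apply Continuous.intervalIntegrable; fun_prop
    rw [e1 _ _ huc hq, e1 _ _ (by fun_prop) (by fun_prop)] at h
    have h2 : ∫ s in (0:ℝ)..1, ((q s + t * w s) ^ 2 / 2
          - b * ((1 - s) * Real.sin (u s + t * η s))) ≤
        ∫ s in (0:ℝ)..1, (((q s) ^ 2 / 2 - b * ((1 - s) * Real.sin (u s)))
          + (t * ((w s) ^ 2 + ((P 1 - P s) * w s - g s * η s))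
          + t ^ 2 * ((w s) ^ 2 / 2 + 2 * (b * ((1 - s) * (η s) ^ 2))))) := by
      apply intervalIntegral.integral_mono_on zero_le_one
      · apply Continuous.intervalIntegrable; fun_prop
      · apply Continuous.intervalIntegrable; fun_prop
      · intro s hs
        have k := aux_sin_taylor (u s) (t * η s)
        have hbs : 0 ≤ b * (1 - s) := mul_nonneg hb.le (by linarith [hs.2])
        have k2 := mul_le_mul_of_nonneg_left k hbs
        have hqs : q s = w s + (P 1 - P s) := by simp only [hw]; ring
        have hgs : g s = b * ((1 - s) * Real.cos (u s)) := rfl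
        rw [hqs, hgs]
        nlinarith
    rw [intervalIntegral.integral_add, intervalIntegral.integral_add,
      intervalIntegral.integral_const_mul, intervalIntegral.integral_const_mul,
      intervalIntegral.integral_add, parts] at h2
    · linarith
    all_goals (apply Continuous.intervalIntegrable; fun_prop)
  have hA0 : A ≤ 0 := by
    by_contra hpos
    push Not at hpos
    have hC0 : 0 ≤ |C| + 1 := by positivity
    have h := main (-(A / (2 * (|C| + 1))))
    set D := |C| + 1 with hD
    have hDp : 0 < D := by positivity
    have hCD : C ≤ D := by linarith [le_abs_self C]
    have h3 : (-(A / (2 * D))) ^ 2 * C ≤ (-(A / (2 * D))) ^ 2 * D :=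
      mul_le_mul_of_nonneg_left hCD (sq_nonneg _)
    have h4 : -(A / (2 * D)) * A + (-(A / (2 * D))) ^ 2 * D = - (A ^ 2 / (4 * D)) := by
      field_simp; ring
    have h5 : 0 < A ^ 2 / (4 * D) := by positivity
    linarith
  intro s hs
  have hz := aux_zero (fun s => (w s) ^ 2) (by fun_prop) (fun s _ => sq_nonneg _) hA0 s hs
  have hz' : w s = 0 := by simpa using hz
  have hsub : P 1 - P s = ∫ t in s..1, g t :=
    intervalIntegral.integral_interval_sub_left (hgc.intervalIntegrable _ _)
      (hgc.intervalIntegrable _ _)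
  rw [← hsub]
  have : q s - (P 1 - P s) = 0 := hz'
  linarith

lemma aux_trunc_lip (x y : ℝ) : |min |x| (π / 2) - min |y| (π / 2)| ≤ |x - y| :=
  (abs_min_sub_min_le_max _ _ _ _).trans (by simpa using abs_abs_sub_abs_le x y)

/-- The minimizer takes values in `[0, π/2]`. -/
lemma aux_range (b : ℝ) (hb : 0 < b) (u q : ℝ → ℝ) (hq : Continuous q)
    (hu : u = fun s => ∫ t in (0:ℝ)..s, q t)
    (hmin : ∀ ψ ψ', InH101 ψ ψ' → energy b u q ≤ energy b ψ ψ') :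
    ∀ s ∈ Icc (0:ℝ) 1, u s ∈ Icc 0 (π / 2) := by
  have hpi := Real.pi_pos
  have hud : ∀ s, HasDerivAt u (q s) s := by
    intro s; rw [hu]; exact aux_prim q hq s
  have huc : Continuous u := continuous_iff_continuousAt.2 fun s => (hud s).continuousAt
  have hu0 : u 0 = 0 := by simp [hu]
  set ψ : ℝ → ℝ := fun s => min |u s| (π / 2) with hψ
  have hψc : Continuous ψ := by fun_prop
  have hder : ∀ s, |deriv ψ s| ≤ |q s| := by
    intro s
    apply le_of_forall_pos_le_add
    intro ε hε
    have hlit := (hasDerivAt_iff_isLittleO.1 (hud s)).def hε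
    have := norm_deriv_le_of_lip' (f := ψ) (x₀ := s) (C := |q s| + ε) (by positivity) (by
      filter_upwards [hlit] with y hy
      have h1 := aux_trunc_lip (u y) (u s)
      simp only [Real.norm_eq_abs, smul_eq_mul] at hy ⊢
      have h2 : |u y - u s| ≤ |u y - u s - (y - s) * q s| + |(y - s) * q s| := by
        simpa using abs_add_le (u y - u s - (y - s) * q s) ((y - s) * q s)
      rw [abs_mul] at h2
      have h3 : |ψ y - ψ s| ≤ |u y - u s| := h1
      nlinarith)
    simpa using this
  have hac : ∀ s, 0 ≤ s → AbsolutelyContinuousOnInterval ψ 0 s := by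
    intro s hs
    have hucd : ContDiff ℝ 1 u := by
      rw [contDiff_one_iff_deriv]
      refine ⟨fun s => (hud s).differentiableAt, ?_⟩
      have : deriv u = q := funext fun s => (hud s).deriv
      rwa [this]
    obtain ⟨K, hK⟩ := hucd.contDiffOn.exists_lipschitzOnWith (s := uIcc 0 s) (by decide)
      (convex_Icc _ _) isCompact_Icc
    have : LipschitzOnWith K ψ (uIcc 0 s) := by
      apply LipschitzOnWith.of_dist_le_mul
      intro x hx y hy
      refine le_trans ?_ (hK.dist_le_mul x hx y hy)
      exact aux_trunc_lip (u x) (u y)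
    exact this.absolutelyContinuousOnInterval
  have hmeas : Measurable (deriv ψ) := measurable_deriv ψ
  have hq2 : IntervalIntegrable (fun s => (q s) ^ 2) volume 0 1 := by
    apply Continuous.intervalIntegrable; fun_prop
  have hd2 : ∀ s, (deriv ψ s) ^ 2 ≤ (q s) ^ 2 := fun s => sq_le_sq.2 (hder s)
  have hψ2 : IntervalIntegrable (fun s => (deriv ψ s) ^ 2) volume 0 1 := by
    apply hq2.mono_fun' (by fun_prop)
    filter_upwards with s
    rw [Real.norm_eq_abs, abs_of_nonneg (sq_nonneg _)]
    exact hd2 s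
  have hin : InH101 ψ (deriv ψ) := by
    refine ⟨fun s hs => ?_, (hac 1 zero_le_one).intervalIntegrable_deriv, hψ2⟩
    rw [(hac s hs.1).integral_deriv_eq_sub]
    have : ψ 0 = 0 := by
      simp only [hψ, hu0, abs_zero]
      exact min_eq_left (by positivity)
    rw [this, sub_zero]
  have hE := hmin _ _ hin
  have hI : ∫ s in (0:ℝ)..1, (deriv ψ s) ^ 2 ≤ ∫ s in (0:ℝ)..1, (q s) ^ 2 :=
    intervalIntegral.integral_mono_on zero_le_one hψ2 hq2 fun s _ => hd2 s
  have hsin : ∀ x : ℝ, Real.sin x ≤ Real.sin (min |x| (π / 2)) := by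
    intro x
    rcases le_total |x| (π / 2) with h | h
    · rw [min_eq_left h]
      rcases le_total 0 x with hx | hx
      · rw [abs_of_nonneg hx]
      · rw [abs_of_nonpos hx, Real.sin_neg]
        rw [abs_of_nonpos hx] at h
        have := Real.sin_nonpos_of_nonpos_of_neg_pi_le hx (by linarith)
        linarith
    · rw [min_eq_right h, Real.sin_pi_div_two]; exact Real.sin_le_one x
  have hI2 : ∫ s in (0:ℝ)..1, (1 - s) * (Real.sin (ψ s) - Real.sin (u s)) ≤ 0 := by
    simp only [mul_sub]
    rw [intervalIntegral.integral_sub]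
    · unfold energy at hE
      by_contra hcon
      push Not at hcon
      nlinarith [mul_pos hb hcon]
    all_goals (apply Continuous.intervalIntegrable; fun_prop)
  have hz := aux_zero (fun s => (1 - s) * (Real.sin (ψ s) - Real.sin (u s))) (by fun_prop)
    (fun s hs => mul_nonneg (by linarith [hs.2]) (sub_nonneg.2 (hsin _))) hI2
  have heq : ∀ s ∈ Ico (0:ℝ) 1, Real.sin (ψ s) = Real.sin (u s) := by
    intro s hs
    rcases mul_eq_zero.1 (hz s ⟨hs.1, hs.2.le⟩) with h | h
    · linarith [hs.2]
    · linarith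
  have hico : ∀ s ∈ Ico (0:ℝ) 1, u s ∈ Icc 0 (π / 2) := by
    intro s hs
    constructor
    · by_contra hneg
      push Not at hneg
      set c := max (u s) (-(π / 4)) with hc
      have hc0 : c < 0 := max_lt hneg (by linarith)
      have hc1 : -(π / 4) ≤ c := le_max_right _ _
      obtain ⟨x, hx, hxc⟩ := intermediate_value_Icc' hs.1 huc.continuousOn
        (show c ∈ Icc (u s) (u 0) from ⟨le_max_left _ _, by rw [hu0]; exact hc0.le⟩)
      have h1 := heq x ⟨hx.1, hx.2.trans_lt hs.2⟩
      simp only [hψ, hxc] at h1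
      rw [abs_of_neg hc0, min_eq_left (by linarith), Real.sin_neg] at h1
      have := Real.sin_neg_of_neg_of_neg_pi_lt hc0 (by linarith)
      linarith
    · by_contra hneg
      push Not at hneg
      set c := min (u s) (3 * π / 4) with hc
      have hc0 : π / 2 < c := lt_min hneg (by linarith)
      have hc1 : c ≤ 3 * π / 4 := min_le_right _ _
      obtain ⟨x, hx, hxc⟩ := intermediate_value_Icc hs.1 huc.continuousOn
        (show c ∈ Icc (u 0) (u s) from ⟨by rw [hu0]; linarith, min_le_left _ _⟩)
      have h1 := heq x ⟨hx.1, hx.2.trans_lt hs.2⟩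
      simp only [hψ, hxc] at h1
      rw [abs_of_pos (by linarith), min_eq_right hc0.le, Real.sin_pi_div_two] at h1
      have h2 : Real.cos c < 0 := Real.cos_neg_of_pi_div_two_lt_of_lt hc0 (by linarith)
      nlinarith [Real.sin_sq_add_cos_sq c]
  intro s hs
  have hcl : IsClosed (u ⁻¹' Icc 0 (π / 2)) := isClosed_Icc.preimage huc
  have hsub : closure (Ico (0:ℝ) 1) ⊆ u ⁻¹' Icc 0 (π / 2) := closure_minimal hico hcl
  rw [closure_Ico (by norm_num)] at hsub
  exact hsub hs

lemma aux_core (b : ℝ) (hb : 0 < b) (u q : ℝ → ℝ) (hq : Continuous q)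
    (hu : u = fun s => ∫ t in (0:ℝ)..s, q t)
    (hmin : ∀ ψ ψ', InH101 ψ ψ' → energy b u q ≤ energy b ψ ψ') :
    0 ≤ q 0 ∧ q 0 ≥ (b / 2) * (∫ s in (0:ℝ)..1, Real.cos (u s)) ∧
    (q 0) ^ 2 ≥ (b / 2) * Real.sin (u 1) ∧
    2 * (1 - Real.sin 1) - 1 / b ≤ Real.sin (u 1) := by
  have hpi := Real.pi_pos
  have hEL := aux_EL b hb u q hq hu hmin
  have hR := aux_range b hb u q hq hu hmin
  have hud : ∀ s, HasDerivAt u (q s) s := by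
    intro s; rw [hu]; exact aux_prim q hq s
  have huc : Continuous u := continuous_iff_continuousAt.2 fun s => (hud s).continuousAt
  have hu0 : u 0 = 0 := by simp [hu]
  have hcos : ∀ s ∈ Icc (0:ℝ) 1, 0 ≤ Real.cos (u s) := fun s hs =>
    Real.cos_nonneg_of_neg_pi_div_two_le_of_le (by linarith [(hR s hs).1]) (hR s hs).2
  have hg0 : ∀ t ∈ Icc (0:ℝ) 1, 0 ≤ b * ((1 - t) * Real.cos (u t)) := fun t ht =>
    mul_nonneg hb.le (mul_nonneg (by linarith [ht.2]) (hcos t ht))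
  have hgc : Continuous fun t => b * ((1 - t) * Real.cos (u t)) := by fun_prop
  have hq0 : ∀ s ∈ Icc (0:ℝ) 1, 0 ≤ q s := by
    intro s hs
    rw [hEL s hs]
    exact intervalIntegral.integral_nonneg hs.2 fun t ht => hg0 t ⟨hs.1.trans ht.1, ht.2⟩
  have hqK : ∀ s ∈ Icc (0:ℝ) 1, q s ≤ q 0 := by
    intro s hs
    rw [hEL s hs, hEL 0 ⟨le_rfl, zero_le_one⟩,
      ← intervalIntegral.integral_add_adjacent_intervals (hgc.intervalIntegrable 0 s)
        (hgc.intervalIntegrable s 1)]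
    have := intervalIntegral.integral_nonneg (μ := volume) hs.1
      fun t ht => hg0 t ⟨ht.1, ht.2.trans hs.2⟩
    linarith
  have hmono : MonotoneOn u (Icc 0 1) := by
    apply monotoneOn_of_deriv_nonneg (convex_Icc 0 1) huc.continuousOn
      (fun s _ => (hud s).differentiableAt.differentiableWithinAt)
    intro s hs
    rw [(hud s).deriv]
    exact hq0 s (interior_subset hs)
  have hanti : AntitoneOn (fun s => Real.cos (u s)) (Icc 0 1) := fun x hx y hy hxy =>
    Real.cos_le_cos_of_nonneg_of_le_pi (hR x hx).1 (by linarith [(hR y hy).2]) (hmono hx hy hxy)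
  have hcc : Continuous fun s => Real.cos (u s) := by fun_prop
  -- Chebyshev
  have cheb : (1 / 2) * (∫ s in (0:ℝ)..1, Real.cos (u s)) ≤
      ∫ s in (0:ℝ)..1, (1 - s) * Real.cos (u s) := by
    have h1 : 0 ≤ ∫ s in (0:ℝ)..1, (1 / 2 - s) * (Real.cos (u s) - Real.cos (u (1 / 2))) := by
      apply intervalIntegral.integral_nonneg zero_le_one
      intro s hs
      have hhalf : (1 / 2 : ℝ) ∈ Icc (0:ℝ) 1 := by constructor <;> norm_num
      rcases le_total s (1 / 2) with h | h
      · have := hanti hs hhalf h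
        exact mul_nonneg (by linarith) (sub_nonneg.2 this)
      · have := hanti hhalf hs h
        exact mul_nonneg_of_nonpos_of_nonpos (by linarith) (sub_nonpos.2 this)
    have h2 : ∫ s in (0:ℝ)..1, (1 / 2 - s) * (Real.cos (u s) - Real.cos (u (1 / 2))) =
        (∫ s in (0:ℝ)..1, (1 - s) * Real.cos (u s))
        - ((1 / 2) * (∫ s in (0:ℝ)..1, Real.cos (u s)))
        - (∫ s in (0:ℝ)..1, (1 / 2 - s)) * Real.cos (u (1 / 2)) := by
      rw [← intervalIntegral.integral_const_mul, ← intervalIntegral.integral_mul_const,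
        ← intervalIntegral.integral_sub, ← intervalIntegral.integral_sub]
      · congr 1; ext s; ring
      all_goals (apply Continuous.intervalIntegrable; fun_prop)
    have h3 : ∫ s in (0:ℝ)..1, (1 / 2 - s) = 0 := by
      rw [intervalIntegral.integral_sub (by simp) (by simp)]
      simp
    rw [h3] at h2
    linarith
  have hK : q 0 = b * ∫ s in (0:ℝ)..1, (1 - s) * Real.cos (u s) := by
    rw [hEL 0 ⟨le_rfl, zero_le_one⟩, intervalIntegral.integral_const_mul]
  have hK0 : 0 ≤ q 0 := hq0 0 ⟨le_rfl, zero_le_one⟩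
  have c1 : q 0 ≥ (b / 2) * (∫ s in (0:ℝ)..1, Real.cos (u s)) := by
    have := mul_le_mul_of_nonneg_left cheb hb.le
    rw [hK]; linarith
  refine ⟨hK0, c1, ?_, ?_⟩
  · have h1 : ∫ s in (0:ℝ)..1, Real.cos (u s) * q s = Real.sin (u 1) := by
      rw [intervalIntegral.integral_eq_sub_of_hasDerivAt (f := fun s => Real.sin (u s))
        (fun s _ => (hud s).sin) (by apply Continuous.intervalIntegrable; fun_prop)]
      simp [hu0]
    have h2 : ∫ s in (0:ℝ)..1, Real.cos (u s) * q s ≤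
        ∫ s in (0:ℝ)..1, Real.cos (u s) * q 0 := by
      apply intervalIntegral.integral_mono_on zero_le_one
      · apply Continuous.intervalIntegrable; fun_prop
      · apply Continuous.intervalIntegrable; fun_prop
      · intro s hs
        exact mul_le_mul_of_nonneg_left (hqK s hs) (hcos s hs)
    rw [h1, intervalIntegral.integral_mul_const] at h2
    have h3 := mul_le_mul_of_nonneg_right c1 hK0
    have h4 := mul_le_mul_of_nonneg_left h2 (by positivity : 0 ≤ b / 2)
    nlinarith
  · have hin : InH101 (fun s => s) (fun _ => 1) := by
      refine ⟨fun s _ => by simp, by simp, by simp⟩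
    have h := hmin _ _ hin
    have e : ∫ s in (0:ℝ)..1, (1 - s) * Real.sin s = 1 - Real.sin 1 := by
      rw [intervalIntegral.integral_eq_sub_of_hasDerivAt
        (f := fun s => -((1 - s) * Real.cos s) - Real.sin s) ?_
        (by apply Continuous.intervalIntegrable; fun_prop)]
      · simp; ring
      · intro s _
        have h1 := (((hasDerivAt_id s).const_sub 1).mul (Real.hasDerivAt_cos s)).neg.sub
          (Real.hasDerivAt_sin s)
        refine HasDerivAt.congr_deriv (f := fun s => -((1 - s) * Real.cos s) - Real.sin s) h1 ?_
        simp only [id]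
        ring
    have h2 : ∫ s in (0:ℝ)..1, (1 - s) * Real.sin (u s) ≤
        ∫ s in (0:ℝ)..1, (1 - s) * Real.sin (u 1) := by
      apply intervalIntegral.integral_mono_on zero_le_one
      · apply Continuous.intervalIntegrable; fun_prop
      · apply Continuous.intervalIntegrable; fun_prop
      · intro s hs
        have h1 : (1:ℝ) ∈ Icc (0:ℝ) 1 := ⟨zero_le_one, le_rfl⟩
        refine mul_le_mul_of_nonneg_left ?_ (by linarith [hs.2])
        exact Real.sin_le_sin_of_le_of_le_pi_div_two (by linarith [(hR s hs).1]) (hR 1 h1).2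
          (hmono hs h1 hs.2)
    have h3 : ∫ s in (0:ℝ)..1, (1 - s) = 1 / 2 := by
      rw [intervalIntegral.integral_sub (by simp) (by simp)]
      simp
      norm_num
    rw [intervalIntegral.integral_mul_const, h3] at h2
    have h4 : 0 ≤ ∫ s in (0:ℝ)..1, (q s) ^ 2 :=
      intervalIntegral.integral_nonneg zero_le_one fun s _ => sq_nonneg _
    unfold energy at h
    rw [e] at h
    simp only [one_pow, intervalIntegral.integral_const, sub_zero, smul_eq_mul, mul_one] at h
    have h5 := mul_le_mul_of_nonneg_left h2 hb.le
    have h6 : 2 * (1 - Real.sin 1) * b - 1 ≤ Real.sin (u 1) * b := by linarith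
    have h7 : 2 * (1 - Real.sin 1) - 1 / b = (2 * (1 - Real.sin 1) * b - 1) / b := by
      field_simp
    rw [h7, div_le_iff₀ hb]
    exact h6

lemma aux_transfer (b : ℝ) (hb : 0 < b) (θ p : ℝ → ℝ) (hm : IsMinimizer b θ p)
    (hc : ContinuousOn p (Icc 0 1)) :
    0 ≤ p 0 ∧ p 0 ≥ (b / 2) * (∫ s in (0:ℝ)..1, Real.cos (θ s)) ∧
    (p 0) ^ 2 ≥ (b / 2) * Real.sin (θ 1) ∧
    2 * (1 - Real.sin 1) - 1 / b ≤ Real.sin (θ 1) := by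
  set q : ℝ → ℝ := IccExtend (zero_le_one (α := ℝ)) ((Icc (0:ℝ) 1).domRestrict p) with hq
  have hqc : Continuous q := (continuousOn_iff_continuous_domRestrict.1 hc).Icc_extend'
  have hqp : ∀ s ∈ Icc (0:ℝ) 1, q s = p s := by
    intro s hs
    rw [hq, IccExtend_of_mem _ _ hs]; rfl
  have hut : ∀ s ∈ Icc (0:ℝ) 1, (∫ t in (0:ℝ)..s, q t) = θ s := by
    intro s hs
    rw [hm.1.1 s hs]
    apply intervalIntegral.integral_congr
    intro t ht
    rw [uIcc_of_le hs.1] at ht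
    exact hqp t ⟨ht.1, ht.2.trans hs.2⟩
  have hE : energy b (fun s => ∫ t in (0:ℝ)..s, q t) q = energy b θ p := by
    unfold energy
    congr 2
    · apply intervalIntegral.integral_congr
      intro t ht
      rw [uIcc_of_le zero_le_one] at ht
      simp only [hqp t ht]
    · apply intervalIntegral.integral_congr
      intro t ht
      rw [uIcc_of_le zero_le_one] at ht
      simp only [hut t ht]
  have h := aux_core b hb _ q hqc rfl (fun ψ ψ' hψ => hE ▸ hm.2 ψ ψ' hψ)
  have hcosi : ∫ s in (0:ℝ)..1, Real.cos (∫ t in (0:ℝ)..s, q t) =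
      ∫ s in (0:ℝ)..1, Real.cos (θ s) := by
    apply intervalIntegral.integral_congr
    intro t ht
    rw [uIcc_of_le zero_le_one] at ht
    simp only [hut t ht]
  rw [hcosi] at h
  simp only [hut 1 ⟨zero_le_one, le_rfl⟩, hqp 0 ⟨le_rfl, zero_le_one⟩] at h
  exact h

/-- for the global minimizer `θ_b`, the initial slope
`K_b = θ_b'(0)` satisfies `K_b ≥ (b/2)∫₀¹ cos θ_b` and
`K_b² ≥ (b/2) sin θ_b(1)`, and `K_b → ∞` as `b → ∞`. -/
theorem initial_slope_diverges (Θ Θ' : ℝ → ℝ → ℝ)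
    (hmin : ∀ b : ℝ, 0 < b → IsMinimizer b (Θ b) (Θ' b))
    (hcont : ∀ b : ℝ, 0 < b → ContinuousOn (Θ' b) (Set.Icc 0 1)) :
    (∀ b : ℝ, 0 < b →
      Θ' b 0 ≥ (b / 2) * ∫ s in (0:ℝ)..1, Real.cos (Θ b s)) ∧
    (∀ b : ℝ, 0 < b → (Θ' b 0)^2 ≥ (b / 2) * Real.sin (Θ b 1)) ∧
    Filter.Tendsto (fun b => Θ' b 0) Filter.atTop Filter.atTop := by
  have H := fun b hb => aux_transfer b hb (Θ b) (Θ' b) (hmin b hb) (hcont b hb)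
  refine ⟨fun b hb => (H b hb).2.1, fun b hb => (H b hb).2.2.1, ?_⟩
  have hs1 : Real.sin 1 < 1 := by
    have := Real.sin_lt_sin_of_lt_of_le_pi_div_two (x := 1) (y := π / 2)
      (by linarith [Real.pi_gt_three]) le_rfl (by linarith [Real.pi_gt_three])
    rwa [Real.sin_pi_div_two] at this
  set c := 1 - Real.sin 1 with hc
  have hcp : 0 < c := by linarith
  rw [Filter.tendsto_atTop]
  intro M
  filter_upwards [Filter.eventually_ge_atTop (1 / c), Filter.eventually_ge_atTop (2 * M ^ 2 / c),
    Filter.eventually_gt_atTop 0] with b h1 h2 hb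
  obtain ⟨k0, -, k2, k3⟩ := H b hb
  have h3 : 1 / b ≤ c := by
    rw [div_le_iff₀ hcp] at h1
    rw [div_le_iff₀ hb]; linarith
  have h4 : c ≤ Real.sin (Θ b 1) := by linarith
  rw [div_le_iff₀ hcp] at h2
  have h5 : M ^ 2 ≤ (Θ' b 0) ^ 2 := by nlinarith
  exact (abs_le_of_sq_le_sq' h5 k0).2
end
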